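/- arXiv:0810.2452 — 6 statements merged into one kernel-verified Lean document; each statement's English description precedes it below -/
import Mathlib

section
/- Let (Ω, 𝒜, μ, T) be a dynamical system on a standard Borel probability space and let (aₙ) be an increasing sequence of positive reals with aₙ → ∞ and aₙ/n → 0. Suppose that for every ε > 0 and every sequence (ν_k)_{k≥1} of zero-mean Borel probability measures on ℝ there exist a measurable set A with μ(A) < ε and a strictly increasing sequence of positive integers (n_k) such that the Lévy–Prokhorov distance between the law of (1/a_{n_k}) S_{n_k}(1_A − μ(A)) and ν_k tends to 0. Then for every ε > 0 there exists a measurable set A with μ(A) < ε such that for every Borel probability measure ν on ℝ there exists a strictly increasing sequence (n_k) with the laws of (1/a_{n_k}) S_{n_k}(1_A − μ(A)) converging weakly to ν. -/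
open MeasureTheory Filter Topology Set BoundedContinuousFunction

open TopologicalSpace

/-- The average of a bounded function under truncation to `[-n, n]`, followed by the mixture that
restores the zero mean. -/
noncomputable def centeredTruncation (ν : Measure ℝ) (n : ℕ) : Measure ℝ :=
  ENNReal.ofReal (n / (n + 1)) • ν.map (fun x => max (-n : ℝ) (min n x)) +
    ENNReal.ofReal (1 / (n + 1)) • Measure.dirac (-(n * ∫ x, max (-n : ℝ) (min n x) ∂ν))

lemma abs_max_neg_min_le (n : ℕ) (x : ℝ) : |max (-n : ℝ) (min n x)| ≤ n :=
  abs_le.2 ⟨le_max_left _ _, max_le (by linarith [n.cast_nonneg (α := ℝ)]) (min_le_left _ _)⟩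

lemma tendsto_max_neg_min (x : ℝ) :
    Tendsto (fun n : ℕ => max (-n : ℝ) (min n x)) atTop (𝓝 x) := by
  refine tendsto_const_nhds.congr' ?_
  filter_upwards [eventually_ge_atTop ⌈|x|⌉₊] with n hn
  have h := abs_le.1 ((Nat.le_ceil |x|).trans (Nat.cast_le.2 hn))
  rw [min_eq_right h.2, max_eq_right h.1]

section centeredTruncation

variable (ν : Measure ℝ) [IsProbabilityMeasure ν] (n : ℕ)

instance isProbabilityMeasure_centeredTruncation :
    IsProbabilityMeasure (centeredTruncation ν n) := by
  have := Measure.isProbabilityMeasure_map (μ := ν) (f := fun x => max (-n : ℝ) (min n x))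
    (by fun_prop)
  constructor
  simp only [centeredTruncation, Measure.coe_add, Measure.coe_smul, Pi.add_apply, Pi.smul_apply,
    measure_univ, smul_eq_mul, mul_one]
  rw [← ENNReal.ofReal_add (by positivity) (by positivity), ← ENNReal.ofReal_one]
  congr 1
  field_simp

lemma integrable_centeredTruncation {f : ℝ → ℝ} (hf : Continuous f) :
    Integrable f (centeredTruncation ν n) := by
  refine (Integrable.smul_measure ?_ ENNReal.ofReal_ne_top).add_measure
    ((integrable_dirac (by simp)).smul_measure ENNReal.ofReal_ne_top)
  rw [integrable_map_measure (by fun_prop) (by fun_prop)]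
  obtain ⟨C, hC⟩ := (isCompact_Icc (a := (-n : ℝ)) (b := n)).exists_bound_of_continuousOn
    hf.continuousOn
  exact Integrable.of_bound (by fun_prop) C
    (.of_forall fun x => hC _ (abs_le.1 (abs_max_neg_min_le n x)))

lemma integral_centeredTruncation {f : ℝ → ℝ} (hf : Continuous f) :
    ∫ x, f x ∂centeredTruncation ν n =
      n / (n + 1) * ∫ x, f (max (-n : ℝ) (min n x)) ∂ν +
        1 / (n + 1) * f (-(n * ∫ x, max (-n : ℝ) (min n x) ∂ν)) := by
  have h := integrable_centeredTruncation ν n hf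
  rw [centeredTruncation, integrable_add_measure] at h
  rw [centeredTruncation, integral_add_measure h.1 h.2, integral_smul_measure,
    integral_smul_measure, integral_dirac, integral_map (by fun_prop) (by fun_prop),
    ENNReal.toReal_ofReal (by positivity), ENNReal.toReal_ofReal (by positivity)]
  rfl

lemma integral_id_centeredTruncation : ∫ x, x ∂centeredTruncation ν n = 0 := by
  rw [integral_centeredTruncation ν n continuous_id']
  field_simp
  ring

lemma centeredTruncation_compl_Icc :
    centeredTruncation ν n (Icc (-(n * n + n : ℕ) : ℝ) (n * n + n : ℕ))ᶜ = 0 := by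
  have hn : (0 : ℝ) ≤ n := n.cast_nonneg
  have hm : |n * ∫ x, max (-n : ℝ) (min n x) ∂ν| ≤ n * n := by
    rw [abs_mul, Nat.abs_cast]
    gcongr
    have h : ∀ᵐ x ∂ν, ‖max (-n : ℝ) (min n x)‖ ≤ n := .of_forall (abs_max_neg_min_le n)
    simpa using norm_integral_le_of_norm_le_const h
  rw [abs_le] at hm
  simp only [centeredTruncation, Measure.coe_add, Measure.coe_smul, Pi.add_apply, Pi.smul_apply,
    smul_eq_mul, add_eq_zero, mul_eq_zero]
  refine ⟨.inr ?_, .inr ?_⟩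
  · rw [Measure.map_apply (by fun_prop) measurableSet_Icc.compl]
    convert measure_empty (μ := ν)
    refine eq_empty_of_forall_notMem fun x hx => hx ?_
    have := abs_le.1 (abs_max_neg_min_le n x)
    push_cast
    constructor <;> nlinarith
  · rw [Measure.dirac_apply' _ measurableSet_Icc.compl]
    refine indicator_of_notMem (notMem_compl_iff.2 ?_) _
    push_cast
    constructor <;> linarith

lemma tendsto_integral_centeredTruncation (φ : ℝ →ᵇ ℝ) :
    Tendsto (fun n => ∫ x, φ x ∂centeredTruncation ν n) atTop (𝓝 (∫ x, φ x ∂ν)) := by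
  simp_rw [integral_centeredTruncation ν _ φ.continuous]
  have h₁ : Tendsto (fun n : ℕ => ∫ x, φ (max (-n : ℝ) (min n x)) ∂ν) atTop
      (𝓝 (∫ x, φ x ∂ν)) :=
    tendsto_integral_of_dominated_convergence (fun _ => ‖φ‖)
      (fun n => (φ.continuous.comp (by fun_prop)).aestronglyMeasurable)
      (integrable_const _) (fun n => .of_forall fun x => φ.norm_coe_le_norm _)
      (.of_forall fun x => (φ.continuous.tendsto x).comp (tendsto_max_neg_min x))
  have h₂ : Tendsto
      (fun n : ℕ => 1 / ((n : ℝ) + 1) * φ (-(n * ∫ x, max (-n : ℝ) (min n x) ∂ν)))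
      atTop (𝓝 0) := by
    refine squeeze_zero_norm (a := fun n : ℕ => 1 / ((n : ℝ) + 1) * ‖φ‖) (fun n => ?_) ?_
    · rw [norm_mul, Real.norm_of_nonneg (by positivity)]
      gcongr
      exact φ.norm_coe_le_norm _
    · simpa using tendsto_one_div_add_atTop_nhds_zero_nat.mul_const ‖φ‖
  simpa using (tendsto_natCast_div_add_atTop (1 : ℝ)).mul h₁ |>.add h₂

end centeredTruncation

/-- The zero-mean probability measures supported in the interval `[-N, N]`. -/
def centeredProbabilityMeasures (N : ℕ) : Set (ProbabilityMeasure ℝ) :=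
  {ρ | (ρ : Measure ℝ) (Icc (-N : ℝ) N)ᶜ = 0 ∧
    Integrable (fun x : ℝ => x) (ρ : Measure ℝ) ∧ ∫ x, x ∂(ρ : Measure ℝ) = 0}

lemma isSeparable_centeredProbabilityMeasures (N : ℕ) :
    IsSeparable (centeredProbabilityMeasures N) := by
  refine (IsCompact.isSeparable (isCompact_closure_of_isTightMeasureSet ?_)).mono subset_closure
  rw [isTightMeasureSet_iff_exists_isCompact_measure_compl_le]
  refine fun ε _ => ⟨Icc (-N : ℝ) N, isCompact_Icc, ?_⟩
  rintro _ ⟨ρ, hρ, rfl⟩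
  simp [hρ.1]

lemma dense_iUnion_centeredProbabilityMeasures :
    Dense (⋃ N, centeredProbabilityMeasures N) := fun ν =>
  mem_closure_of_tendsto
    (f := fun n => (⟨centeredTruncation ν n, inferInstance⟩ : ProbabilityMeasure ℝ))
    (ProbabilityMeasure.tendsto_iff_forall_integral_tendsto.2 fun φ =>
      tendsto_integral_centeredTruncation (ν : Measure ℝ) φ)
    (.of_forall fun n => mem_iUnion.2 ⟨n * n + n, centeredTruncation_compl_Icc _ n,
      integrable_centeredTruncation _ n continuous_id', integral_id_centeredTruncation _ n⟩)

/-- In a separable space, a dense set contains a sequence clustering at every point. -/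
lemma exists_seq_forall_mapClusterPt {X : Type*} [TopologicalSpace X] [PseudoMetrizableSpace X]
    [Nonempty X] {s : Set X} (hs : IsSeparable s) (hd : Dense s) :
    ∃ u : ℕ → X, (∀ k, u k ∈ s) ∧ ∀ x, MapClusterPt x atTop u := by
  obtain ⟨c, hcs, hc, hsc⟩ := hs.exists_countable_dense_subset
  have hcd : Dense c := fun x => closure_minimal hsc isClosed_closure (hd x)
  obtain ⟨e, rfl⟩ := hc.exists_eq_range hcd.nonempty
  refine ⟨fun k => e k.unpair.1, fun k => hcs (mem_range_self _), fun x => ?_⟩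
  rw [mapClusterPt_iff_frequently]
  intro U hU
  obtain ⟨_, hjU, j, rfl⟩ := mem_closure_iff_nhds.1 (hcd x) U hU
  exact frequently_atTop.2 fun m =>
    ⟨Nat.pair j m, Nat.right_le_pair j m, by simpa using hjU⟩

/-- A sequence of laws asymptotic to `ρ` in the Lévy–Prokhorov distance has the same weak limit as
`ρ`. -/
lemma tendsto_of_tendsto_levyProkhorovDist {P ρ : ℕ → ProbabilityMeasure ℝ}
    {ν : ProbabilityMeasure ℝ} (hρ : Tendsto ρ atTop (𝓝 ν))
    (h : Tendsto (fun k => levyProkhorovDist (P k : Measure ℝ) (ρ k)) atTop (𝓝 0)) :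
    Tendsto P atTop (𝓝 ν) := by
  have hρ' := (LevyProkhorov.continuous_ofMeasure_probabilityMeasure.tendsto ν).comp hρ
  have hP : Tendsto (fun k => LevyProkhorov.ofMeasure (P k)) atTop
      (𝓝 (LevyProkhorov.ofMeasure ν)) := by
    refine hρ'.congr_dist (h.congr fun k => ?_)
    rw [dist_comm]
    rfl
  exact (LevyProkhorov.continuous_toMeasure_probabilityMeasure.tendsto _).comp hP

/-- If a dynamical system realizes, for every `ε > 0` and every sequence of
zero-mean probability measures `ν k`, a set `A` with `μ A < ε` whose normalized partial
sums along a strictly increasing sequence `n k` approximate `ν k` in the Lévy–Prokhorov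
distance, then for every `ε > 0` there is a single set `A` with `μ A < ε` whose
normalized partial sums have every probability measure on `ℝ` as a weak limit point. -/
theorem indicator_limit_of_sequence_approx
    {Ω : Type*} [MeasurableSpace Ω] [StandardBorelSpace Ω]
    (μ : Measure Ω) [IsProbabilityMeasure μ]
    (T : Ω → Ω) (hT : MeasurePreserving T μ μ) (hTbij : Function.Bijective T)
    (a : ℕ → ℝ) (ha_pos : ∀ n, 0 < a n) (ha_mono : Monotone a)
    (ha_top : Tendsto a atTop atTop)
    (ha_small : Tendsto (fun n => a n / n) atTop (𝓝 0))
    (H : ∀ ε : ℝ, 0 < ε →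
      ∀ ν : ℕ → Measure ℝ, (∀ k ≥ 1, IsProbabilityMeasure (ν k)) →
        (∀ k ≥ 1, Integrable (fun x : ℝ => x) (ν k)) →
        (∀ k ≥ 1, ∫ x, x ∂(ν k) = 0) →
        ∃ A : Set Ω, MeasurableSet A ∧ μ A < ENNReal.ofReal ε ∧
          ∃ n : ℕ → ℕ, StrictMono n ∧ (∀ k, 1 ≤ n k) ∧
            Tendsto
              (fun k => levyProkhorovDist
                (μ.map (fun x => (a (n k))⁻¹ *
                  ∑ i ∈ Finset.range (n k),
                    (A.indicator (fun _ => (1 : ℝ)) (T^[i] x) - (μ A).toReal)))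
                (ν k))
              atTop (𝓝 0)) :
    ∀ ε : ℝ, 0 < ε →
      ∃ A : Set Ω, MeasurableSet A ∧ μ A < ENNReal.ofReal ε ∧
        ∀ ν : Measure ℝ, IsProbabilityMeasure ν →
          ∃ n : ℕ → ℕ, StrictMono n ∧ (∀ k, 1 ≤ n k) ∧
            ∀ φ : ℝ →ᵇ ℝ,
              Tendsto
                (fun k => ∫ x, φ ((a (n k))⁻¹ *
                  ∑ i ∈ Finset.range (n k),
                    (A.indicator (fun _ => (1 : ℝ)) (T^[i] x) - (μ A).toReal)) ∂μ)
                atTop (𝓝 (∫ y, φ y ∂ν)) := by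
  intro ε hε
  obtain ⟨u, hu, hcl⟩ := exists_seq_forall_mapClusterPt
    (IsSeparable.iUnion isSeparable_centeredProbabilityMeasures)
    dense_iUnion_centeredProbabilityMeasures
  choose N hN using fun k => mem_iUnion.1 (hu k)
  obtain ⟨A, hA, hAε, n, hn, hn1, hlim⟩ := H ε hε (fun k => u k) (fun _ _ => inferInstance)
    (fun k _ => (hN k).2.1) (fun k _ => (hN k).2.2)
  refine ⟨A, hA, hAε, fun ν hν => ?_⟩
  obtain ⟨ψ, hψ, hψlim⟩ := (hcl ⟨ν, hν⟩).tendsto_subseq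
  refine ⟨n ∘ ψ, hn.comp hψ, fun k => hn1 _, fun φ => ?_⟩
  have hmeas (m : ℕ) : AEMeasurable (fun x => (a m)⁻¹ *
      ∑ i ∈ Finset.range m, (A.indicator (fun _ => (1 : ℝ)) (T^[i] x) - (μ A).toReal)) μ :=
    ((Finset.measurable_fun_sum _ fun i _ => ((measurable_const.indicator hA).comp
      (hT.measurable.iterate i)).sub_const _).const_mul _).aemeasurable
  have hP := tendsto_of_tendsto_levyProkhorovDist
    (P := fun k => ProbabilityMeasure.map ⟨μ, inferInstance⟩ (hmeas (n (ψ k))))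
    hψlim (hlim.comp hψ.tendsto_atTop)
  refine ((ProbabilityMeasure.tendsto_iff_forall_integral_tendsto.1 hP) φ).congr fun k => ?_
  exact integral_map (hmeas (n (ψ k))) φ.continuous.aestronglyMeasurable
end

section
/- Let (Ω, 𝒜, μ, T) be a dynamical system and let (aₙ) be an increasing sequence of positive reals with aₙ → ∞ and aₙ/n → 0. Let A ∈ 𝒜 be a measurable set, ν a Borel probability measure on ℝ, and (n_k) a strictly increasing sequence of positive integers such that the laws of (1/a_{n_k}) S_{n_k}(1_A − μ(A)) converge weakly to ν. Then the conditional expectation of 1_A with respect to the σ-algebra ℐ of T-invariant sets equals the constant μ(A) μ-almost surely. -/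
open MeasureTheory Filter Topology Set BoundedContinuousFunction

/-- The σ-algebra of `T`-invariant measurable sets. -/
def invariantsSigma {Ω : Type*} [MeasurableSpace Ω] (T : Ω → Ω) : MeasurableSpace Ω where
  MeasurableSet' s := MeasurableSet s ∧ T ⁻¹' s = s
  measurableSet_empty := ⟨MeasurableSet.empty, Set.preimage_empty⟩
  measurableSet_compl := fun s hs => ⟨hs.1.compl, by rw [Set.preimage_compl, hs.2]⟩
  measurableSet_iUnion := fun f hf =>
    ⟨MeasurableSet.iUnion fun i => (hf i).1, by
      rw [Set.preimage_iUnion]; exact Set.iUnion_congr fun i => (hf i).2⟩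

/-- A bounded continuous cutoff, vanishing on `[-M, M]` and equal to `1` outside
`[-(M + 1), M + 1]`. -/
noncomputable def tailCutoff (M : ℝ) : ℝ →ᵇ ℝ :=
  BoundedContinuousFunction.ofNormedAddCommGroup (fun y => min 1 (max 0 (|y| - M)))
    (by fun_prop) 1 (fun y => by
      rw [Real.norm_eq_abs, abs_of_nonneg (le_min zero_le_one (le_max_left _ _))]
      exact min_le_left _ _)

lemma tailCutoff_apply (M y : ℝ) : tailCutoff M y = min 1 (max 0 (|y| - M)) := rfl

lemma tailCutoff_nonneg (M y : ℝ) : 0 ≤ tailCutoff M y :=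
  le_min zero_le_one (le_max_left _ _)

lemma tailCutoff_le_one (M y : ℝ) : tailCutoff M y ≤ 1 := min_le_left _ _

lemma tendsto_integral_tailCutoff (ν : Measure ℝ) [IsFiniteMeasure ν] :
    Tendsto (fun M : ℕ => ∫ y, tailCutoff M y ∂ν) atTop (𝓝 0) := by
  have h := tendsto_integral_of_dominated_convergence (μ := ν)
    (F := fun (M : ℕ) y => tailCutoff M y) (f := fun _ => 0) (fun _ => (1 : ℝ))
    (fun M => (tailCutoff M).continuous.aestronglyMeasurable) (integrable_const _)
    (fun M => ae_of_all _ fun y => by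
      rw [Real.norm_eq_abs, abs_of_nonneg (tailCutoff_nonneg _ _)]
      exact tailCutoff_le_one _ _)
    (ae_of_all _ fun y => by
      refine tendsto_const_nhds.congr' ?_
      filter_upwards [eventually_ge_atTop ⌈|y|⌉₊] with M hM
      have : |y| - M ≤ 0 := sub_nonpos.2 (Nat.ceil_le.1 hM)
      simp [tailCutoff_apply, max_eq_left this])
  simpa using h

lemma abs_div_le_add_tailCutoff {s a N M : ℝ} (ha : 0 < a) (hN : 0 < N) (hM : 0 ≤ M)
    (hs : |s| ≤ N) : |s| / N ≤ a / N * (M + 1) + tailCutoff M (a⁻¹ * s) := by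
  have habs : |a⁻¹ * s| = |s| / a := by
    rw [abs_mul, abs_of_pos (inv_pos.2 ha), div_eq_inv_mul]
  rcases le_total (|s| / a) (M + 1) with h | h
  · have h1 : |s| / N ≤ a / N * (M + 1) := by
      rw [div_le_iff₀ ha] at h
      rw [div_mul_eq_mul_div]
      gcongr
      linarith
    linarith [tailCutoff_nonneg M (a⁻¹ * s)]
  · have h1 : tailCutoff M (a⁻¹ * s) = 1 := by
      rw [tailCutoff_apply, habs]
      exact min_eq_left (le_max_of_le_right (by linarith))
    have h2 : |s| / N ≤ 1 := (div_le_one hN).2 hs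
    have h3 : 0 ≤ a / N * (M + 1) := by positivity
    linarith

lemma invariantsSigma_le {Ω : Type*} [m : MeasurableSpace Ω] (T : Ω → Ω) :
    invariantsSigma T ≤ m := fun _ hs => hs.1

lemma setIntegral_comp_iterate_of_invariant {Ω : Type*} [MeasurableSpace Ω] {μ : Measure Ω}
    {T : Ω → Ω} (hT : MeasurePreserving T μ μ) {B : Set Ω} (hB : MeasurableSet B)
    (hTB : T ⁻¹' B = B) {X : Ω → ℝ} (hX : Measurable X) (i : ℕ) :
    ∫ x in B, X (T^[i] x) ∂μ = ∫ x in B, X x ∂μ := by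
  have hpre : T^[i] ⁻¹' B = B := by
    rw [Set.preimage_iterate_eq]
    exact Function.iterate_fixed hTB i
  have h := (hT.iterate i).restrict_preimage hB
  rw [hpre] at h
  have h2 := integral_map h.measurable.aemeasurable
    (hX.aestronglyMeasurable (μ := Measure.map T^[i] (μ.restrict B)))
  rw [h.map_eq] at h2
  exact h2.symm

/-- The integral of an observable over an invariant set is bounded by the `L¹` norms of its
Birkhoff averages. -/
lemma abs_setIntegral_le_integral_abs_sum_div {Ω : Type*} [MeasurableSpace Ω] {μ : Measure Ω}
    {T : Ω → Ω} (hT : MeasurePreserving T μ μ) {B : Set Ω} (hB : MeasurableSet B)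
    (hTB : T ⁻¹' B = B) {X : Ω → ℝ} (hX : Measurable X) (hXi : Integrable X μ)
    {N : ℕ} (hN : 0 < N) :
    |∫ x in B, X x ∂μ| ≤ ∫ x, |∑ i ∈ Finset.range N, X (T^[i] x)| / N ∂μ := by
  have hcomp (i : ℕ) : Integrable (fun x => X (T^[i] x)) μ :=
    (hT.iterate i).integrable_comp_of_integrable hXi
  have hN' : (0 : ℝ) < N := Nat.cast_pos.2 hN
  have hsum : ∫ x in B, (∑ i ∈ Finset.range N, X (T^[i] x)) ∂μ = N * ∫ x in B, X x ∂μ := by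
    rw [integral_finsetSum _ fun i _ => (hcomp i).integrableOn]
    simp [setIntegral_comp_iterate_of_invariant hT hB hTB hX]
  rw [integral_div, le_div_iff₀ hN', mul_comm]
  nth_rw 1 [← abs_of_pos hN']
  rw [← abs_mul, ← hsum]
  refine abs_integral_le_integral_abs.trans ?_
  exact setIntegral_le_integral (integrable_finsetSum _ fun i _ => hcomp i).abs
    (ae_of_all _ fun x => abs_nonneg _)

/-- If `S_{n k}(X) / a_{n k}` converges in law for a bounded observable `X` and `a m = o(m)`,
then `X` has zero integral over every invariant set. -/
lemma setIntegral_eq_zero_of_tendsto_law {Ω : Type*} [MeasurableSpace Ω]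
    {μ : Measure Ω} [IsProbabilityMeasure μ] {T : Ω → Ω} (hT : MeasurePreserving T μ μ)
    {a : ℕ → ℝ} (ha_pos : ∀ n, 0 < a n) (ha_small : Tendsto (fun n => a n / n) atTop (𝓝 0))
    {X : Ω → ℝ} (hX : Measurable X) (hX1 : ∀ x, |X x| ≤ 1)
    {ν : Measure ℝ} [IsFiniteMeasure ν]
    {n : ℕ → ℕ} (hn_mono : StrictMono n) (hn_pos : ∀ k, 1 ≤ n k)
    (hconv : ∀ φ : ℝ →ᵇ ℝ,
      Tendsto (fun k => ∫ x, φ ((a (n k))⁻¹ * ∑ i ∈ Finset.range (n k), X (T^[i] x)) ∂μ)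
        atTop (𝓝 (∫ y, φ y ∂ν)))
    {B : Set Ω} (hB : MeasurableSet B) (hTB : T ⁻¹' B = B) :
    ∫ x in B, X x ∂μ = 0 := by
  have hXi : Integrable X μ := .of_bound hX.aestronglyMeasurable 1 (ae_of_all _ hX1)
  have hS (k : ℕ) : Measurable (fun x => ∑ i ∈ Finset.range k, X (T^[i] x)) :=
    Finset.measurable_sum _ fun i _ => hX.comp (hT.iterate i).measurable
  have hSle (k : ℕ) (x : Ω) : |∑ i ∈ Finset.range k, X (T^[i] x)| ≤ k :=
    (Finset.abs_sum_le_sum_abs _ _).trans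
      ((Finset.sum_le_sum fun i _ => hX1 (T^[i] x)).trans (by simp))
  have key (M k : ℕ) : |∫ x in B, X x ∂μ| ≤ a (n k) / n k * (M + 1) +
      ∫ x, tailCutoff M ((a (n k))⁻¹ * ∑ i ∈ Finset.range (n k), X (T^[i] x)) ∂μ := by
    have hN : (0 : ℝ) < n k := Nat.cast_pos.2 (hn_pos k)
    refine (abs_setIntegral_le_integral_abs_sum_div hT hB hTB hX hXi (hn_pos k)).trans ?_
    have hφ : Integrable (fun x =>
        tailCutoff M ((a (n k))⁻¹ * ∑ i ∈ Finset.range (n k), X (T^[i] x))) μ :=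
      .of_bound ((tailCutoff M).continuous.measurable.comp
        ((hS (n k)).const_mul _)).aestronglyMeasurable 1 (ae_of_all _ fun x => by
          rw [Real.norm_eq_abs, abs_of_nonneg (tailCutoff_nonneg _ _)]
          exact tailCutoff_le_one _ _)
    have hSi : Integrable (fun x => |∑ i ∈ Finset.range (n k), X (T^[i] x)| / n k) μ :=
      (Integrable.of_bound (hS (n k)).aestronglyMeasurable (n k)
        (ae_of_all _ (hSle (n k)))).abs.div_const _
    calc _ ≤ ∫ x, (a (n k) / n k * (M + 1) +
          tailCutoff M ((a (n k))⁻¹ * ∑ i ∈ Finset.range (n k), X (T^[i] x))) ∂μ :=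
          integral_mono hSi ((integrable_const _).add hφ) fun x =>
            abs_div_le_add_tailCutoff (ha_pos _) hN M.cast_nonneg (hSle _ x)
      _ = _ := by rw [integral_add (integrable_const _) hφ]; simp
  have hM (M : ℕ) : |∫ x in B, X x ∂μ| ≤ ∫ y, tailCutoff M y ∂ν := by
    refine ge_of_tendsto' (f := fun k => a (n k) / n k * (M + 1) +
      ∫ x, tailCutoff M ((a (n k))⁻¹ * ∑ i ∈ Finset.range (n k), X (T^[i] x)) ∂μ)
      (x := atTop) ?_ (key M)
    simpa using ((ha_small.comp hn_mono.tendsto_atTop).mul_const ((M : ℝ) + 1)).add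
      (hconv (tailCutoff M))
  exact abs_nonpos_iff.1 (ge_of_tendsto' (tendsto_integral_tailCutoff ν) hM)

/-- If the laws of the normalized partial sums `(a (n k))⁻¹ S_{n k}(1_A − μ A)`
converge weakly to some probability measure `ν` on `ℝ`, then the conditional expectation
of `1_A` with respect to the σ-algebra of `T`-invariant sets is a.s. equal to `μ A`. -/
theorem condexp_invariants_eq_measure_of_limit
    {Ω : Type*} [MeasurableSpace Ω] [StandardBorelSpace Ω]
    (μ : Measure Ω) [IsProbabilityMeasure μ]
    (T : Ω → Ω) (hT : MeasurePreserving T μ μ) (hTbij : Function.Bijective T)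
    (a : ℕ → ℝ) (ha_pos : ∀ n, 0 < a n) (ha_mono : Monotone a)
    (ha_top : Tendsto a atTop atTop)
    (ha_small : Tendsto (fun n => a n / n) atTop (𝓝 0))
    (A : Set Ω) (hA : MeasurableSet A)
    (ν : Measure ℝ) (hν : IsProbabilityMeasure ν)
    (n : ℕ → ℕ) (hn_mono : StrictMono n) (hn_pos : ∀ k, 1 ≤ n k)
    (hconv : ∀ φ : ℝ →ᵇ ℝ,
      Tendsto
        (fun k => ∫ x, φ ((a (n k))⁻¹ *
          ∑ i ∈ Finset.range (n k),
            (A.indicator (fun _ => (1 : ℝ)) (T^[i] x) - (μ A).toReal)) ∂μ)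
        atTop (𝓝 (∫ y, φ y ∂ν))) :
    μ[A.indicator (fun _ => (1 : ℝ)) | invariantsSigma T] =ᵐ[μ]
      fun _ => (μ A).toReal := by
  set f : Ω → ℝ := A.indicator fun _ => (1 : ℝ)
  have hfm : Measurable f := measurable_const.indicator hA
  have hf1 (x : Ω) : 0 ≤ f x ∧ f x ≤ 1 :=
    ⟨Set.indicator_nonneg (fun _ _ => zero_le_one) x,
      Set.indicator_le_self' (fun _ _ => zero_le_one) x⟩
  have hfi : Integrable f μ := (integrable_const 1).indicator hA
  have hc0 : 0 ≤ (μ A).toReal := ENNReal.toReal_nonneg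
  have hc1 : (μ A).toReal ≤ 1 := measureReal_le_one
  refine (ae_eq_condExp_of_forall_setIntegral_eq (invariantsSigma_le T) hfi
    (fun s _ _ => (integrable_const _).integrableOn) (fun s hs _ => ?_)
    aestronglyMeasurable_const).symm
  have h := setIntegral_eq_zero_of_tendsto_law hT ha_pos ha_small
    (X := fun x => f x - (μ A).toReal) (hfm.sub_const _)
    (fun x => abs_le.2 ⟨by linarith [(hf1 x).1], by linarith [(hf1 x).2]⟩)
    hn_mono hn_pos hconv hs.1 hs.2
  rw [integral_sub hfi.integrableOn (integrable_const _)] at h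
  linarith
end

section
/- Let (Ω, 𝒜, μ) be a probability space, let f, g : Ω → ℝ be measurable functions, and let ν be a Borel probability measure on ℝ. Then d(ℒ(f+g), ν) ≤ d(ℒ(f), ν) + d(ℒ(g), δ₀), where d is the Lévy metric, ℒ(h) denotes the law (pushforward of μ) of a measurable function h, and δ₀ is the Dirac measure at 0. -/
open MeasureTheory Filter Topology Set

/-- The Lévy metric between two Borel measures on `ℝ`, defined via their cumulative
distribution functions. -/
noncomputable def levyDist (μ ν : Measure ℝ) : ℝ :=
  sInf {ε : ℝ | 0 < ε ∧ ∀ t : ℝ,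
    ProbabilityTheory.cdf ν (t - ε) - ε ≤ ProbabilityTheory.cdf μ t ∧
    ProbabilityTheory.cdf μ t ≤ ProbabilityTheory.cdf ν (t + ε) + ε}

open ProbabilityTheory in
/-- Any number exceeding the Lévy distance bounds some admissible `ε`. -/
lemma exists_lt_of_levyDist_lt (μ ν : Measure ℝ) {c : ℝ} (hc : levyDist μ ν < c) :
    ∃ ε < c, 0 < ε ∧ ∀ t : ℝ, cdf ν (t - ε) - ε ≤ cdf μ t ∧ cdf μ t ≤ cdf ν (t + ε) + ε := by
  obtain ⟨ε, hε, hlt⟩ := exists_lt_of_csInf_lt (by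
    exact ⟨1, one_pos, fun t => ⟨by linarith [cdf_le_one ν (t - 1), cdf_nonneg μ t],
      by linarith [cdf_le_one μ t, cdf_nonneg ν (t + 1)]⟩⟩) hc
  exact ⟨ε, hlt, hε⟩

open ProbabilityTheory in
lemma levyDist_le_of_forall (μ ν : Measure ℝ) {ε : ℝ} (hε : 0 < ε)
    (h : ∀ t : ℝ, cdf ν (t - ε) - ε ≤ cdf μ t ∧ cdf μ t ≤ cdf ν (t + ε) + ε) :
    levyDist μ ν ≤ ε :=
  csInf_le ⟨0, fun _ hx => hx.1.le⟩ ⟨hε, h⟩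

lemma cdf_map_eq_real {Ω : Type*} [MeasurableSpace Ω] (μ : Measure Ω) [IsProbabilityMeasure μ]
    {h : Ω → ℝ} (hh : Measurable h) (t : ℝ) :
    ProbabilityTheory.cdf (μ.map h) t = μ.real {ω | h ω ≤ t} := by
  have := Measure.isProbabilityMeasure_map (μ := μ) hh.aemeasurable
  rw [ProbabilityTheory.cdf_eq_real, map_measureReal_apply hh measurableSet_Iic]
  rfl

lemma cdf_dirac_zero_of_neg {t : ℝ} (ht : t < 0) :
    ProbabilityTheory.cdf (Measure.dirac (0 : ℝ)) t = 0 := by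
  simp [ProbabilityTheory.cdf_eq_real, measureReal_def, ht]

lemma cdf_dirac_zero_of_nonneg {t : ℝ} (ht : 0 ≤ t) :
    ProbabilityTheory.cdf (Measure.dirac (0 : ℝ)) t = 1 := by
  simp [ProbabilityTheory.cdf_eq_real, measureReal_def, ht]

/-- For measurable `f g : Ω → ℝ` on a probability space and a Borel
probability measure `ν` on `ℝ`, the Lévy distance of the law of `f + g` to `ν` is at
most the Lévy distance of the law of `f` to `ν` plus the Lévy distance of the law of
`g` to the Dirac measure at `0`. -/
theorem levyDist_add_le
    {Ω : Type*} [MeasurableSpace Ω] (μ : Measure Ω) [IsProbabilityMeasure μ]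
    (f g : Ω → ℝ) (hf : Measurable f) (hg : Measurable g)
    (ν : Measure ℝ) [IsProbabilityMeasure ν] :
    levyDist (μ.map (fun ω => f ω + g ω)) ν ≤
      levyDist (μ.map f) ν + levyDist (μ.map g) (Measure.dirac 0) := by
  refine le_of_forall_pos_le_add fun δ hδ => ?_
  obtain ⟨a, ha_lt, ha_pos, ha⟩ :=
    exists_lt_of_levyDist_lt (μ.map f) ν (lt_add_of_pos_right _ (half_pos hδ))
  set b := levyDist (μ.map g) (Measure.dirac 0) + δ / 2 with hb_def
  obtain ⟨β, hβb, hβ_pos, hβ⟩ :=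
    exists_lt_of_levyDist_lt (μ.map g) (Measure.dirac 0) (lt_add_of_pos_right _ (half_pos hδ))
  rw [← hb_def] at hβb
  have hleft : μ.real {ω | g ω ≤ -b} ≤ b := by
    have h := (hβ (-b)).2
    rw [cdf_dirac_zero_of_neg (by linarith), cdf_map_eq_real μ hg] at h
    linarith
  have hright : 1 - b ≤ μ.real {ω | g ω ≤ b} := by
    have h := (hβ b).1
    rw [cdf_dirac_zero_of_nonneg (by linarith), cdf_map_eq_real μ hg] at h
    linarith
  have hcompl : μ.real {ω | g ω ≤ b}ᶜ ≤ b := by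
    rw [probReal_compl_eq_one_sub (measurableSet_le hg measurable_const)]
    linarith
  refine (levyDist_le_of_forall _ ν (ε := a + b) (by linarith) fun t => ?_).trans (by linarith)
  rw [cdf_map_eq_real μ (hf.fun_add hg)]
  constructor
  · have h := (ha (t - b)).1
    rw [cdf_map_eq_real μ hf, sub_sub, add_comm b a] at h
    have hsub : {ω | f ω ≤ t - b} ⊆ {ω | f ω + g ω ≤ t} ∪ {ω | g ω ≤ b}ᶜ := by
      intro ω hω
      by_cases hgω : g ω ≤ b
      · exact Or.inl (by simp only [mem_ofPred_eq] at *; linarith)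
      · exact Or.inr hgω
    have := (measureReal_mono (μ := μ) hsub).trans (measureReal_union_le _ _)
    linarith
  · have h := (ha (t + b)).2
    rw [cdf_map_eq_real μ hf, add_assoc t b a, add_comm b a] at h
    have hsub : {ω | f ω + g ω ≤ t} ⊆ {ω | f ω ≤ t + b} ∪ {ω | g ω ≤ -b} := by
      intro ω hω
      by_cases hgω : g ω ≤ -b
      · exact Or.inr hgω
      · exact Or.inl (by simp only [mem_ofPred_eq] at *; linarith)
    have := (measureReal_mono (μ := μ) hsub).trans (measureReal_union_le _ _)
    linarith
end

section
/- Let ν be a Borel probability measure on ℝ and let A ≥ 0. Then d(ν, δ₀) ≤ A if and only if ν((−∞, −A)) ≤ A and ν((A, ∞)) ≤ A, where d is the Lévy metric and δ₀ is the Dirac measure at 0. -/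
open MeasureTheory Filter Topology Set

/-- Upper bounds on the measures of an increasing sequence of sets pass to the limit. -/
theorem measure_iUnion_le_ofReal {α : Type*} [MeasurableSpace α] {ν : Measure α}
    {s : ℕ → Set α} (hs : Monotone s) {u : ℕ → ℝ} {A : ℝ} (hu : Tendsto u atTop (𝓝 A))
    (h : ∀ n, ν (s n) ≤ ENNReal.ofReal (u n)) : ν (⋃ n, s n) ≤ ENNReal.ofReal A :=
  le_of_tendsto_of_tendsto' (tendsto_measure_iUnion_atTop hs) (ENNReal.tendsto_ofReal hu) h

theorem cdf_dirac_zero (t : ℝ) :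
    ProbabilityTheory.cdf (Measure.dirac (0 : ℝ)) t = if 0 ≤ t then 1 else 0 := by
  rw [ProbabilityTheory.cdf_eq_real, measureReal_def, Measure.dirac_apply' _ measurableSet_Iic]
  by_cases h : 0 ≤ t <;> simp [h]

theorem measureReal_Ioi_eq_one_sub_cdf (ν : Measure ℝ) [IsProbabilityMeasure ν] (t : ℝ) :
    ν.real (Ioi t) = 1 - ProbabilityTheory.cdf ν t := by
  rw [ProbabilityTheory.cdf_eq_real, ← compl_Iic, probReal_compl_eq_one_sub measurableSet_Iic]

/-- Membership in the set defining `levyDist ν (Measure.dirac 0)`, in terms of the tails of `ν`. -/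
theorem levy_dirac_condition_iff (ν : Measure ℝ) [IsProbabilityMeasure ν] (ε : ℝ) (hε : 0 < ε) :
    (∀ t : ℝ,
      ProbabilityTheory.cdf (Measure.dirac 0) (t - ε) - ε ≤ ProbabilityTheory.cdf ν t ∧
      ProbabilityTheory.cdf ν t ≤ ProbabilityTheory.cdf (Measure.dirac 0) (t + ε) + ε) ↔
    (∀ t < -ε, ProbabilityTheory.cdf ν t ≤ ε) ∧ 1 - ε ≤ ProbabilityTheory.cdf ν ε := by
  simp only [cdf_dirac_zero]
  constructor
  · intro h
    refine ⟨fun t ht => ?_, by simpa using (h ε).1⟩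
    simpa [show ¬ 0 ≤ t + ε by linarith] using (h t).2
  · rintro ⟨hl, hr⟩ t
    have h0 := ProbabilityTheory.cdf_nonneg ν t
    have h1 := ProbabilityTheory.cdf_le_one ν t
    constructor
    · split_ifs with ht
      · exact hr.trans (ProbabilityTheory.monotone_cdf ν (by linarith))
      · linarith
    · split_ifs with ht
      · linarith
      · linarith [hl t (by linarith)]

/-- For a Borel probability measure `ν` on `ℝ` and `A ≥ 0`, one has
`d(ν, δ₀) ≤ A` (Lévy metric) iff `ν (-∞, -A) ≤ A` and `ν (A, ∞) ≤ A`. -/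
theorem levyDist_dirac_le_iff
    (ν : Measure ℝ) [IsProbabilityMeasure ν] (A : ℝ) (hA : 0 ≤ A) :
    levyDist ν (Measure.dirac 0) ≤ A ↔
      ν (Iio (-A)) ≤ ENNReal.ofReal A ∧ ν (Ioi A) ≤ ENNReal.ofReal A := by
  have hne : {ε : ℝ | 0 < ε ∧ ∀ t : ℝ,
      ProbabilityTheory.cdf (Measure.dirac 0) (t - ε) - ε ≤ ProbabilityTheory.cdf ν t ∧
      ProbabilityTheory.cdf ν t ≤
        ProbabilityTheory.cdf (Measure.dirac 0) (t + ε) + ε}.Nonempty := by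
    refine ⟨1, one_pos, (levy_dirac_condition_iff ν 1 one_pos).2 ⟨fun t _ => ?_, ?_⟩⟩
    · exact ProbabilityTheory.cdf_le_one ν t
    · simpa using ProbabilityTheory.cdf_nonneg ν 1
  constructor
  · intro h
    have key : ∀ ε, A < ε →
        ν (Iic (-ε)) ≤ ENNReal.ofReal ε ∧ ν (Ioi ε) ≤ ENNReal.ofReal ε := by
      intro ε hAε
      obtain ⟨δ, ⟨hδ, hc⟩, hδε⟩ := exists_lt_of_csInf_lt hne (h.trans_lt hAε)
      obtain ⟨hl, hr⟩ := (levy_dirac_condition_iff ν δ hδ).1 hc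
      rw [← ofReal_measureReal, ← ofReal_measureReal, measureReal_Ioi_eq_one_sub_cdf,
        ← ProbabilityTheory.cdf_eq_real]
      constructor <;> apply ENNReal.ofReal_le_ofReal
      · linarith [hl (-ε) (by linarith)]
      · linarith [ProbabilityTheory.monotone_cdf ν hδε.le]
    obtain ⟨u, hu, huA, hlim⟩ := exists_seq_strictAnti_tendsto A
    have hl : Iio (-A) = ⋃ n, Iic (-u n) := by
      ext x
      simp only [mem_Iio, mem_iUnion, mem_Iic]
      refine ⟨fun hx => ?_, fun ⟨n, hn⟩ => by linarith [huA n]⟩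
      obtain ⟨n, hn⟩ := (hlim.eventually_lt_const (show A < -x by linarith)).exists
      exact ⟨n, by linarith⟩
    have hr : Ioi A = ⋃ n, Ioi (u n) := by
      ext x
      simp only [mem_Ioi, mem_iUnion]
      exact ⟨fun hx => (hlim.eventually_lt_const hx).exists, fun ⟨n, hn⟩ => (huA n).trans hn⟩
    rw [hl, hr]
    exact ⟨measure_iUnion_le_ofReal
        (fun _ _ hmn => Iic_subset_Iic.2 (neg_le_neg (hu.antitone hmn))) hlim
        fun n => (key _ (huA n)).1,
      measure_iUnion_le_ofReal (fun _ _ hmn => Ioi_subset_Ioi (hu.antitone hmn)) hlim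
        fun n => (key _ (huA n)).2⟩
  · rintro ⟨hl, hr⟩
    refine le_of_forall_gt_imp_ge_of_dense fun ε hAε => ?_
    have hε : 0 < ε := hA.trans_lt hAε
    refine csInf_le ⟨0, fun _ hx => hx.1.le⟩ ⟨hε, (levy_dirac_condition_iff ν ε hε).2 ⟨?_, ?_⟩⟩
    · intro t ht
      rw [ProbabilityTheory.cdf_eq_real]
      have hsub : Iic t ⊆ Iio (-A) := Iic_subset_Iio.2 (by linarith)
      exact (ENNReal.toReal_le_of_le_ofReal hA ((measure_mono hsub).trans hl)).trans hAε.le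
    · have h : ν.real (Ioi A) ≤ A := ENNReal.toReal_le_of_le_ofReal hA hr
      rw [measureReal_Ioi_eq_one_sub_cdf] at h
      linarith [ProbabilityTheory.monotone_cdf ν hAε.le]
end

section
/- Let (aₙ) be an increasing sequence of positive reals with aₙ → ∞. For every Borel probability measure ν on ℝ and every ε > 0, there exist C₀ ≥ 1 and n₀ ∈ ℕ such that for all C ≥ C₀ and n ≥ n₀ there exists a probability measure η on ℝ whose support S is a finite subset of [−aₙC, aₙC] ∩ ℤ, such that η({i}) is rational for every i ∈ S, the mean ∫ x dη(x) equals 0, and d(η_{aₙ}, ν) ≤ ε, where η_{aₙ} denotes the pushforward of η under t ↦ t/aₙ and d is the Lévy metric. -/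
open MeasureTheory Filter Topology Set

/-- The empirical measure of the first `M` terms of an integer sequence. -/
noncomputable def empiricalMeasure (M : ℕ) (z : ℕ → ℤ) : Measure ℝ :=
  ∑ k ∈ Finset.range M, ENNReal.ofReal (1 / M) • Measure.dirac (z k : ℝ)

open scoped Classical in
theorem empiricalMeasure_apply (M : ℕ) (z : ℕ → ℤ) (A : Set ℝ) :
    empiricalMeasure M z A =
      ENNReal.ofReal ((((Finset.range M).filter fun k => (z k : ℝ) ∈ A).card : ℝ) / M) := by
  have h (k : ℕ) : ENNReal.ofReal (1 / M) * (Measure.dirac (z k : ℝ)) A =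
      ENNReal.ofReal (if (z k : ℝ) ∈ A then 1 / (M : ℝ) else 0) := by
    by_cases hk : (z k : ℝ) ∈ A <;> simp [hk]
  simp only [empiricalMeasure, Measure.coe_finsetSum, Finset.sum_apply, Measure.smul_apply,
    smul_eq_mul, h]
  rw [← ENNReal.ofReal_sum_of_nonneg fun k _ => by positivity, ← Finset.sum_filter]
  simp [div_eq_mul_inv]

theorem isProbabilityMeasure_empiricalMeasure {M : ℕ} (hM : 0 < M) (z : ℕ → ℤ) :
    IsProbabilityMeasure (empiricalMeasure M z) := by
  constructor
  have : (M : ℝ) ≠ 0 := by positivity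
  simp [empiricalMeasure_apply, this]

theorem integrable_empiricalMeasure (M : ℕ) (z : ℕ → ℤ) (f : ℝ → ℝ) :
    Integrable f (empiricalMeasure M z) :=
  integrable_finsetSum_measure.2 fun _ _ =>
    (integrable_dirac (by simp)).smul_measure ENNReal.ofReal_ne_top

theorem integral_empiricalMeasure (M : ℕ) (z : ℕ → ℤ) (f : ℝ → ℝ) :
    ∫ x, f x ∂empiricalMeasure M z = (∑ k ∈ Finset.range M, f (z k)) / M := by
  rw [empiricalMeasure, integral_finsetSum_measure fun _ _ =>
    (integrable_dirac (by simp)).smul_measure ENNReal.ofReal_ne_top]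
  simp [integral_smul_measure, Finset.mul_sum, div_eq_inv_mul]

open scoped Classical in
theorem cdf_map_div_empiricalMeasure {M : ℕ} (hM : 0 < M) (z : ℕ → ℤ) (a t : ℝ) :
    ProbabilityTheory.cdf ((empiricalMeasure M z).map fun x => x / a) t =
      (((Finset.range M).filter fun k => (z k : ℝ) / a ≤ t).card : ℝ) / M := by
  have := isProbabilityMeasure_empiricalMeasure hM z
  have hmeas : Measurable fun x : ℝ => x / a := by fun_prop
  have := Measure.isProbabilityMeasure_map (μ := empiricalMeasure M z) hmeas.aemeasurable
  rw [ProbabilityTheory.cdf_eq_real, measureReal_def, Measure.map_apply hmeas measurableSet_Iic,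
    empiricalMeasure_apply, ENNReal.toReal_ofReal (by positivity)]
  rfl

/-- An approximate quantile at level `p`. -/
theorem exists_approx_quantile (ν : Measure ℝ) {p δ : ℝ} (hp₀ : 0 < p) (hp₁ : p < 1)
    (hδ : 0 < δ) :
    ∃ x, p ≤ ProbabilityTheory.cdf ν x ∧ ∀ t, p ≤ ProbabilityTheory.cdf ν t → x ≤ t + δ := by
  set s : Set ℝ := {t | p ≤ ProbabilityTheory.cdf ν t} with hs
  have hne : s.Nonempty :=
    ((ProbabilityTheory.tendsto_cdf_atTop ν).eventually (eventually_ge_nhds hp₁)).exists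
  have hbdd : BddBelow s := by
    obtain ⟨b, hb⟩ :=
      ((ProbabilityTheory.tendsto_cdf_atBot ν).eventually (eventually_lt_nhds hp₀)).exists
    refine ⟨b, fun t ht => ?_⟩
    by_contra! h
    exact absurd (ht.trans (ProbabilityTheory.monotone_cdf ν h.le)) hb.not_ge
  obtain ⟨x, hx, hlt⟩ := exists_lt_of_csInf_lt hne (lt_add_of_pos_right (sInf s) hδ)
  exact ⟨x, hx, fun t ht => hlt.le.trans (by gcongr; exact csInf_le hbdd ht)⟩

theorem card_filter_level_le (N : ℕ) {v : ℝ} (hv : 0 ≤ v) :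
    (((Finset.range N).filter fun k : ℕ => ((k : ℝ) + 1) / (N + 1) ≤ v).card : ℝ) ≤
      (N + 1) * v := by
  have hsub : ((Finset.range N).filter fun k : ℕ => ((k : ℝ) + 1) / (N + 1) ≤ v) ⊆
      Finset.range ⌊(N + 1) * v⌋₊ := by
    intro k hk
    have hk' := (Finset.mem_filter.1 hk).2
    rw [div_le_iff₀ (by positivity)] at hk'
    rw [Finset.mem_range, ← Nat.succ_le_iff]
    apply Nat.le_floor
    push_cast
    linarith
  have hcard := Finset.card_le_card hsub
  rw [Finset.card_range] at hcard
  exact (Nat.cast_le.2 hcard).trans (Nat.floor_le (by positivity))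

theorem le_card_filter_level (N : ℕ) {v : ℝ} (hv₀ : 0 ≤ v) (hv₁ : v ≤ 1) :
    (N + 1) * v - 1 ≤
      (((Finset.range N).filter fun k : ℕ => ((k : ℝ) + 1) / (N + 1) ≤ v).card : ℝ) := by
  have hsub : Finset.range (min N ⌊(N + 1) * v⌋₊) ⊆
      (Finset.range N).filter fun k : ℕ => ((k : ℝ) + 1) / (N + 1) ≤ v := by
    intro k hk
    rw [Finset.mem_range, lt_min_iff] at hk
    refine Finset.mem_filter.2 ⟨Finset.mem_range.2 hk.1, ?_⟩
    rw [div_le_iff₀ (by positivity)]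
    have h := (Nat.le_floor_iff (by positivity)).1 (Nat.succ_le_iff.2 hk.2)
    push_cast at h
    linarith
  have hcard := Finset.card_le_card hsub
  rw [Finset.card_range] at hcard
  refine le_trans ?_ (Nat.cast_le.2 hcard)
  rw [Nat.cast_min, le_min_iff]
  exact ⟨by nlinarith [(N.cast_nonneg : (0 : ℝ) ≤ N)], (Nat.sub_one_lt_floor _).le⟩

/-- If all but the last of the `N + 1` atoms are close to the quantiles of `ν` at the levels
`(k + 1) / (N + 1)`, then the rescaled empirical measure is close to `ν`. -/
theorem levyDist_map_div_empiricalMeasure_le (ν : Measure ℝ) [IsProbabilityMeasure ν]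
    {N : ℕ} {z : ℕ → ℤ} {a ε : ℝ} (hε : 0 < ε) (hN : 1 / ((N : ℝ) + 1) ≤ ε)
    (hupper : ∀ k < N, ∀ t, (z k : ℝ) / a ≤ t →
      ((k : ℝ) + 1) / (N + 1) ≤ ProbabilityTheory.cdf ν (t + ε))
    (hlower : ∀ k < N, ∀ t, ((k : ℝ) + 1) / (N + 1) ≤ ProbabilityTheory.cdf ν (t - ε) →
      (z k : ℝ) / a ≤ t) :
    levyDist ((empiricalMeasure (N + 1) z).map fun x => x / a) ν ≤ ε := by
  classical
  refine csInf_le ⟨0, fun _ h => h.1.le⟩ ⟨hε, fun t => ?_⟩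
  have hM : (0 : ℝ) < (N : ℝ) + 1 := by positivity
  rw [div_le_iff₀ hM] at hN
  rw [cdf_map_div_empiricalMeasure N.succ_pos, le_div_iff₀ (by positivity),
    div_le_iff₀ (by positivity)]
  push_cast
  constructor
  · have h := le_card_filter_level N (ProbabilityTheory.cdf_nonneg ν (t - ε))
      (ProbabilityTheory.cdf_le_one ν (t - ε))
    have hsub : ((Finset.range N).filter fun k : ℕ =>
        ((k : ℝ) + 1) / (N + 1) ≤ ProbabilityTheory.cdf ν (t - ε)) ⊆
        (Finset.range (N + 1)).filter fun k => (z k : ℝ) / a ≤ t := by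
      intro k hk
      rw [Finset.mem_filter, Finset.mem_range] at hk ⊢
      exact ⟨hk.1.trans N.lt_succ_self, hlower k hk.1 t hk.2⟩
    have hcard : (_ : ℝ) ≤ _ := Nat.cast_le.2 (Finset.card_le_card hsub)
    linarith
  · have h := card_filter_level_le N (ProbabilityTheory.cdf_nonneg ν (t + ε))
    have hsub : ((Finset.range (N + 1)).filter fun k => (z k : ℝ) / a ≤ t) ⊆
        insert N ((Finset.range N).filter fun k : ℕ =>
          ((k : ℝ) + 1) / (N + 1) ≤ ProbabilityTheory.cdf ν (t + ε)) := by
      intro k hk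
      rw [Finset.mem_filter, Finset.mem_range] at hk
      rw [Finset.mem_insert, Finset.mem_filter, Finset.mem_range]
      rcases Nat.lt_succ_iff_lt_or_eq.1 hk.1 with hlt | heq
      · exact Or.inr ⟨hlt, hupper k hlt t hk.2⟩
      · exact Or.inl heq
    have hcard : (_ : ℝ) ≤ _ :=
      Nat.cast_le.2 ((Finset.card_le_card hsub).trans (Finset.card_insert_le _ _))
    push_cast at hcard
    linarith

/-- The sequence `⌊b * x k⌋` for `k < N`, continued by the value making the first `N + 1` terms
sum to zero. -/
noncomputable def balancedFloor (N : ℕ) (x : ℕ → ℝ) (b : ℝ) (k : ℕ) : ℤ :=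
  if k < N then ⌊b * x k⌋ else -∑ j ∈ Finset.range N, ⌊b * x j⌋

theorem sum_balancedFloor (N : ℕ) (x : ℕ → ℝ) (b : ℝ) :
    ∑ k ∈ Finset.range (N + 1), balancedFloor N x b k = 0 := by
  have h : ∀ k ∈ Finset.range N, balancedFloor N x b k = ⌊b * x k⌋ :=
    fun k hk => if_pos (Finset.mem_range.1 hk)
  rw [Finset.sum_range_succ, Finset.sum_congr rfl h]
  simp [balancedFloor]

theorem abs_floor_mul_le {b : ℝ} (hb : 1 ≤ b) (x : ℝ) : |(⌊b * x⌋ : ℝ)| ≤ b * (|x| + 1) := by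
  have h₁ := Int.floor_le (b * x)
  have h₂ := Int.lt_floor_add_one (b * x)
  have h₃ : b * x ≤ b * |x| := by gcongr; exact le_abs_self x
  have h₄ : b * -|x| ≤ b * x := by gcongr; exact neg_abs_le x
  rw [abs_le]
  constructor <;> linarith

theorem abs_balancedFloor_le (N : ℕ) (x : ℕ → ℝ) {b : ℝ} (hb : 1 ≤ b) (k : ℕ) :
    |(balancedFloor N x b k : ℝ)| ≤ b * ∑ j ∈ Finset.range N, (|x j| + 1) := by
  rw [balancedFloor, Finset.mul_sum]
  split_ifs with hk
  · exact (abs_floor_mul_le hb (x k)).trans (Finset.single_le_sum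
      (f := fun j => b * (|x j| + 1)) (fun j _ => by positivity) (Finset.mem_range.2 hk))
  · push_cast
    rw [abs_neg]
    exact (Finset.abs_sum_le_sum_abs _ _).trans
      (Finset.sum_le_sum fun j _ => abs_floor_mul_le hb (x j))

/-- Every probability measure `ν` on `ℝ` can be approximated within `ε`
(in the Lévy metric) by the `a n`-rescaling of a zero-mean probability measure `η`
supported on a finite set of integers lying in `[-a n * C, a n * C]`, with all masses
rational, for all large enough `C` and `n`. -/
theorem exists_integer_supported_rational_approx
    (a : ℕ → ℝ) (ha_pos : ∀ n, 0 < a n) (ha_mono : Monotone a)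
    (ha_top : Tendsto a atTop atTop)
    (ν : Measure ℝ) [IsProbabilityMeasure ν] (ε : ℝ) (hε : 0 < ε) :
    ∃ C₀ : ℝ, 1 ≤ C₀ ∧ ∃ n₀ : ℕ, ∀ C : ℝ, C₀ ≤ C → ∀ n : ℕ, n₀ ≤ n →
      ∃ η : Measure ℝ, IsProbabilityMeasure η ∧
        ∃ S : Finset ℤ,
          (∀ i ∈ S, |(i : ℝ)| ≤ a n * C) ∧
          η (((fun i : ℤ => (i : ℝ)) '' (S : Set ℤ))ᶜ) = 0 ∧
          (∀ i ∈ S, ∃ q : ℚ, η {(i : ℝ)} = ENNReal.ofReal (q : ℝ)) ∧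
          Integrable (fun x : ℝ => x) η ∧ (∫ x, x ∂η = 0) ∧
          levyDist (η.map (fun t => t / a n)) ν ≤ ε := by
  obtain ⟨N, hN⟩ := exists_nat_one_div_lt hε
  have hquant (k : ℕ) : ∃ x, k < N → ((k : ℝ) + 1) / (N + 1) ≤ ProbabilityTheory.cdf ν x ∧
      ∀ t, ((k : ℝ) + 1) / (N + 1) ≤ ProbabilityTheory.cdf ν t → x ≤ t + ε := by
    by_cases hk : k < N
    · have hk' : (k : ℝ) < N := by exact_mod_cast hk
      obtain ⟨x, hx⟩ := exists_approx_quantile ν (p := ((k : ℝ) + 1) / (N + 1)) (by positivity)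
        (by rw [div_lt_one (by positivity)]; linarith) hε
      exact ⟨x, fun _ => hx⟩
    · exact ⟨0, fun h => absurd h hk⟩
  choose x hx using hquant
  obtain ⟨n₀, hn₀⟩ := eventually_atTop.1 (ha_top.eventually_ge_atTop (max 1 (1 / ε)))
  refine ⟨max 1 (∑ j ∈ Finset.range N, (|x j| + 1)), le_max_left _ _, n₀, fun C hC n hn => ?_⟩
  have hb : 1 ≤ a n := (le_max_left _ _).trans (hn₀ n hn)
  have hbε : 1 ≤ a n * ε := (div_le_iff₀ hε).1 ((le_max_right _ _).trans (hn₀ n hn))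
  have hb₀ : 0 < a n := ha_pos n
  set z := balancedFloor N x (a n) with hz
  have hzk {k : ℕ} (hk : k < N) : z k = ⌊a n * x k⌋ := if_pos hk
  refine ⟨empiricalMeasure (N + 1) z, isProbabilityMeasure_empiricalMeasure N.succ_pos z,
    (Finset.range (N + 1)).image z, fun i hi => ?_, ?_, fun i _ => ?_,
    integrable_empiricalMeasure _ _ _, ?_, ?_⟩
  · obtain ⟨k, -, rfl⟩ := Finset.mem_image.1 hi
    refine (abs_balancedFloor_le N x hb k).trans ?_
    gcongr
    exact (le_max_right _ _).trans hC
  · rw [empiricalMeasure_apply, @Finset.filter_false_of_mem _ _ (_) _]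
    · simp
    · intro k hk hmem
      exact hmem ⟨z k, Finset.mem_coe.2 (Finset.mem_image_of_mem z hk), rfl⟩
  · classical
    refine ⟨(((Finset.range (N + 1)).filter fun k => (z k : ℝ) ∈ ({(i : ℝ)} : Set ℝ)).card : ℚ) /
      (N + 1 : ℕ), ?_⟩
    rw [empiricalMeasure_apply]
    push_cast
    congr!
  · rw [integral_empiricalMeasure, ← Int.cast_sum, hz, sum_balancedFloor]
    simp
  · refine levyDist_map_div_empiricalMeasure_le ν hε hN.le (fun k hk t ht => ?_)
      fun k hk t ht => ?_
    · refine (hx k hk).1.trans (ProbabilityTheory.monotone_cdf ν ?_)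
      rw [hzk hk, div_le_iff₀ hb₀] at ht
      have h := Int.lt_floor_add_one (a n * x k)
      refine le_of_mul_le_mul_left ?_ hb₀
      linarith
    · have h := (hx k hk).2 _ ht
      rw [hzk hk, div_le_iff₀ hb₀]
      refine (Int.floor_le _).trans ?_
      rw [mul_comm t]
      gcongr
      linarith
end

section
/- Let (Ω, 𝒜, μ, T) be an aperiodic dynamical system on a standard Borel probability space and (aₙ) an increasing sequence of positive reals with aₙ → ∞ and aₙ/n → 0. Let (ν_k)_{k≥1} be a sequence of zero-mean Borel probability measures on ℝ, let ε ∈ (0,1), and let (ε_k)_{k≥1} be a decreasing sequence of positive reals with ∑_k ε_k < ε and ∑_k k·ε_k < ∞. Then there exist pairwise disjoint measurable sets (A_k)_{k≥1} and a strictly increasing sequence of positive integers (n_k)_{k≥1} such that: (i) μ(A₁) ≤ ε₁ and, for all k > 1, μ(A_k) ≤ (a_{n_{k−1}}/n_{k−1}) ε_k; (ii) for all k ≥ 1, d(ℒ((1/a_{n_k}) S_{n_k}(1_{A_k} − μ(A_k))), ν_k) ≤ ε_k; (iii) for all k ≥ 1 and all j > k, d(ℒ((1/a_{n_j}) S_{n_j}(1_{A_k}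 − μ(A_k))), δ₀) ≤ ε_j; where d is the Lévy metric and δ₀ is the Dirac measure at 0. -/
open MeasureTheory Filter Topology Set

section Iterates

variable {Ω : Type*} [MeasurableSpace Ω] {μ : Measure Ω}

lemma measure_preimage_iterate {T : Ω → Ω} (hT : MeasurePreserving T μ μ) (n : ℕ) {s : Set Ω}
    (hs : MeasurableSet s) : μ (T^[n] ⁻¹' s) = μ s :=
  (hT.iterate n).measure_preimage hs.nullMeasurableSet

lemma iterate_symm_iterate (e : Ω ≃ᵐ Ω) (n : ℕ) (x : Ω) : e.symm^[n] (e^[n] x) = x :=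
  Function.LeftInverse.iterate e.symm_apply_apply n x

lemma iterate_iterate_symm (e : Ω ≃ᵐ Ω) (n : ℕ) (x : Ω) : e^[n] (e.symm^[n] x) = x :=
  Function.LeftInverse.iterate e.apply_symm_apply n x

end Iterates

section GreedyMarker

variable {Ω : Type*}

/-- Greedy construction of a set whose first translates are disjoint. -/
def greedyMarker (T : Ω → Ω) (H : ℕ) (E : ℕ → Set Ω) : ℕ → Set Ω
  | 0 => ∅
  | n + 1 => greedyMarker T H E n ∪
      {x | x ∈ E n ∧ ∀ i < H, T^[i] x ∉ greedyMarker T H E n ∧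
        ∀ y ∈ greedyMarker T H E n, T^[i] y ≠ x}

lemma greedyMarker_mono (T : Ω → Ω) (H : ℕ) (E : ℕ → Set Ω) : Monotone (greedyMarker T H E) :=
  monotone_nat_of_le_succ fun _ => subset_union_left

lemma greedyMarker_disjoint (T : Ω → Ω) (H : ℕ) {E : ℕ → Set Ω}
    (hE : ∀ n, ∀ x ∈ E n, ∀ i, 0 < i → i < H → T^[i] x ∉ E n) (n : ℕ) :
    ∀ x ∈ greedyMarker T H E n, ∀ i, 0 < i → i < H → T^[i] x ∉ greedyMarker T H E n := by
  induction n with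
  | zero => intro x hx; exact hx.elim
  | succ n ih =>
    rintro x (hx | hx) i h0 hi (hy | hy)
    · exact ih x hx i h0 hi hy
    · exact (hy.2 i hi).2 x hx rfl
    · exact (hx.2 i hi).1 hy
    · exact hE n x hx.1 i h0 hi hy.1

end GreedyMarker

section Marker

variable {Ω : Type*} [MeasurableSpace Ω] {μ : Measure Ω}

lemma measurableSet_greedyMarker (e : Ω ≃ᵐ Ω) (H : ℕ) {E : ℕ → Set Ω}
    (hE : ∀ n, MeasurableSet (E n)) (n : ℕ) : MeasurableSet (greedyMarker e H E n) := by
  induction n with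
  | zero => exact MeasurableSet.empty
  | succ n ih =>
    have h2 : {x | x ∈ E n ∧ ∀ i < H, e^[i] x ∉ greedyMarker e H E n ∧
        ∀ y ∈ greedyMarker e H E n, e^[i] y ≠ x} =
        E n ∩ ⋂ i, ⋂ (_ : i < H), ((e^[i] ⁻¹' (greedyMarker e H E n))ᶜ ∩
          (e.symm^[i] ⁻¹' (greedyMarker e H E n))ᶜ) := by
      ext x
      simp only [mem_ofPred_eq, mem_inter_iff, mem_iInter, mem_compl_iff, mem_preimage]
      refine and_congr_right fun _ => forall₂_congr fun i _ => and_congr_right fun _ => ?_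
      constructor
      · intro h hx
        exact h _ hx (iterate_iterate_symm e i x)
      · rintro h y hy rfl
        exact h (by rwa [iterate_symm_iterate])
    refine ih.union ?_
    rw [h2]
    refine (hE n).inter (MeasurableSet.iInter fun i => MeasurableSet.iInter fun _ => ?_)
    exact (((e.measurable.iterate i) ih).compl).inter (((e.symm.measurable.iterate i) ih).compl)

lemma exists_countable_cover [StandardBorelSpace Ω] {T : Ω → Ω} (hT : Measurable T)
    (H : ℕ) : ∃ E : ℕ → Set Ω, (∀ n, MeasurableSet (E n)) ∧
      (∀ n, ∀ x ∈ E n, ∀ i, 0 < i → i < H → T^[i] x ∉ E n) ∧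
      ∀ x, (∀ n ≥ 1, T^[n] x ≠ x) → ∃ n, x ∈ E n := by
  obtain ⟨u, hu⟩ := exists_surjective_nat (ℚ × ℚ)
  set φ := embeddingReal Ω
  have hφ := measurableEmbedding_embeddingReal Ω
  let G : ℕ → Set Ω := fun n => φ ⁻¹' (Ioo ((u n).1 : ℝ) ((u n).2 : ℝ))
  have hG : ∀ n, MeasurableSet (G n) := fun n => hφ.measurable measurableSet_Ioo
  refine ⟨fun n => G n ∩ ⋂ i, ⋂ (_ : 0 < i), ⋂ (_ : i < H), (T^[i] ⁻¹' (G n))ᶜ, ?_, ?_, ?_⟩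
  · intro n
    refine (hG n).inter (MeasurableSet.iInter fun i => MeasurableSet.iInter fun _ =>
      MeasurableSet.iInter fun _ => ((hT.iterate i) (hG n)).compl)
  · intro n x hx i h0 hi hy
    have := hx.2
    simp only [mem_iInter, mem_compl_iff, mem_preimage] at this
    exact this i h0 hi hy.1
  · intro x hx
    have hev : ∀ᶠ r in 𝓝 (φ x), ∀ i ∈ Finset.Ico 1 H, r ≠ φ (T^[i] x) := by
      rw [Filter.eventually_all_finset]
      intro i hi
      refine eventually_ne_nhds fun h => hx i (Finset.mem_Ico.1 hi).1 (hφ.injective h).symm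
    obtain ⟨δ, hδ, hball⟩ := Metric.eventually_nhds_iff.1 hev
    obtain ⟨q, hq1, hq2⟩ := exists_rat_btwn (show φ x - δ < φ x by linarith)
    obtain ⟨r, hr1, hr2⟩ := exists_rat_btwn (show φ x < φ x + δ by linarith)
    obtain ⟨n, hn⟩ := hu (q, r)
    refine ⟨n, ?_, ?_⟩
    · simp [G, hn, hq2, hr1]
    · simp only [mem_iInter, mem_compl_iff, mem_preimage]
      intro i h0 hi hmem
      simp only [G, hn, mem_preimage, mem_Ioo] at hmem
      refine hball (y := φ (T^[i] x)) ?_ i (Finset.mem_Ico.2 ⟨h0, hi⟩) rfl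
      rw [Real.dist_eq, abs_lt]
      constructor <;> linarith [hmem.1, hmem.2]

lemma exists_marker [StandardBorelSpace Ω] [IsProbabilityMeasure μ] (e : Ω ≃ᵐ Ω)
    (he : MeasurePreserving e μ μ) (haper : μ {x | ∃ n ≥ 1, e^[n] x = x} = 0) (H : ℕ) :
    ∃ B, MeasurableSet B ∧ (H : ENNReal) * μ B ≤ 1 ∧ ∀ᵐ x ∂μ, ∃ j, e.symm^[j] x ∈ B := by
  obtain ⟨E, hEm, hEd, hEc⟩ := exists_countable_cover e.measurable H
  have hBm : MeasurableSet (⋃ n, greedyMarker e H E n) :=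
    MeasurableSet.iUnion (measurableSet_greedyMarker e H hEm)
  set B := ⋃ n, greedyMarker e H E n with hB
  have hBd : ∀ x ∈ B, ∀ i, 0 < i → i < H → e^[i] x ∉ B := by
    intro x hx i h0 hi hy
    obtain ⟨n, hn⟩ := mem_iUnion.1 hx
    obtain ⟨k, hk⟩ := mem_iUnion.1 hy
    exact greedyMarker_disjoint e H hEd (max n k) x (greedyMarker_mono e H E (le_max_left _ _) hn)
      i h0 hi (greedyMarker_mono e H E (le_max_right _ _) hk)
  refine ⟨B, hBm, ?_, ?_⟩
  · have hdis : Set.PairwiseDisjoint (↑(Finset.range H)) (fun i => e^[i] ⁻¹' B) := by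
      have key : ∀ i j, i < j → j < H → Disjoint (e^[i] ⁻¹' B) (e^[j] ⁻¹' B) := by
        intro i j hij hj
        refine Set.disjoint_left.2 fun x hx hy => hBd _ hx (j - i) (by omega) (by omega) ?_
        rw [← Function.iterate_add_apply, Nat.sub_add_cancel hij.le]
        exact hy
      intro i hi j hj hij
      simp only [Finset.coe_range, mem_Iio] at hi hj
      rcases lt_or_gt_of_ne hij with h | h
      · exact key i j h hj
      · exact (key j i h hi).symm
    have := measure_biUnion_finset (μ := μ) hdis fun i _ => (e.measurable.iterate i) hBm
    simp only [measure_preimage_iterate he _ hBm, Finset.sum_const, Finset.card_range,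
      nsmul_eq_mul] at this
    rw [← this]
    exact prob_le_one
  · have hae : ∀ᵐ x ∂μ, ∀ n ≥ 1, e^[n] x ≠ x := by
      rw [ae_iff]
      convert haper using 3
      push Not
      rfl
    have hae2 : ∀ᵐ x ∂μ, ∀ n ≥ 1, e^[n] (e.symm^[H] x) ≠ e.symm^[H] x :=
      ((he.symm e).iterate H).quasiMeasurePreserving.ae hae
    filter_upwards [hae2] with x hx
    obtain ⟨n, hn⟩ := hEc _ hx
    by_cases hmem : e.symm^[H] x ∈ B
    · exact ⟨H, hmem⟩
    have hnot : e.symm^[H] x ∉ greedyMarker e H E (n + 1) :=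
      fun h => hmem (mem_iUnion.2 ⟨_, h⟩)
    have : ¬ ∀ i < H, e^[i] (e.symm^[H] x) ∉ greedyMarker e H E n ∧
        ∀ y ∈ greedyMarker e H E n, e^[i] y ≠ e.symm^[H] x :=
      fun h => hnot (Or.inr ⟨hn, h⟩)
    push Not at this
    obtain ⟨i, hi, h⟩ := this
    by_cases h1 : e^[i] (e.symm^[H] x) ∈ greedyMarker e H E n
    · refine ⟨H - i, mem_iUnion.2 ⟨n, ?_⟩⟩
      have h3 : e.symm^[H] x = e.symm^[i] (e.symm^[H - i] x) := by
        rw [← Function.iterate_add_apply, Nat.add_sub_cancel' hi.le]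
      rwa [h3, iterate_iterate_symm] at h1
    · obtain ⟨y, hy, hyx⟩ := h h1
      refine ⟨i + H, mem_iUnion.2 ⟨n, ?_⟩⟩
      rw [Function.iterate_add_apply, ← hyx, iterate_symm_iterate]
      exact hy

/-- A clock which at each step either advances by one or is reset to `0`. -/
def IsClock (T : Ω → Ω) (pos : Ω → ℕ) : Prop :=
  Measurable pos ∧ ∀ x, pos (T x) = 0 ∨ pos (T x) = pos x + 1

lemma exists_clock [StandardBorelSpace Ω] [IsProbabilityMeasure μ] (e : Ω ≃ᵐ Ω)
    (he : MeasurePreserving e μ μ) (haper : μ {x | ∃ n ≥ 1, e^[n] x = x} = 0) {ε : ℝ}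
    (hε : 0 < ε) : ∃ pos, IsClock e pos ∧ μ {x | pos x = 0} ≤ ENNReal.ofReal ε := by
  classical
  obtain ⟨H, hH⟩ := exists_nat_gt ε⁻¹
  have hH0 : (0 : ℝ) < H := lt_trans (inv_pos.2 hε) hH
  obtain ⟨B, hBm, hBH, hBae⟩ := exists_marker e he haper H
  let p : Ω → ℕ → Prop := fun x j => e.symm^[j] x ∈ B ∨ ∀ i, e.symm^[i] x ∉ B
  have hp : ∀ x, ∃ j, p x j := by
    intro x
    by_cases h : ∃ j, e.symm^[j] x ∈ B
    · exact ⟨h.choose, Or.inl h.choose_spec⟩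
    · exact ⟨0, Or.inr (not_exists.1 h)⟩
  have hpm : ∀ j, MeasurableSet {x | p x j} := by
    intro j
    have h2 : {x | ∀ i, e.symm^[i] x ∉ B} = ⋂ i, (e.symm^[i] ⁻¹' B)ᶜ := by
      ext x; simp
    have h3 : MeasurableSet {x | ∀ i, e.symm^[i] x ∉ B} := by
      rw [h2]
      exact MeasurableSet.iInter fun i => ((e.symm.measurable.iterate i) hBm).compl
    exact MeasurableSet.union ((e.symm.measurable.iterate j) hBm) h3
  refine ⟨fun x => Nat.find (hp x), ⟨measurable_find hp hpm, fun x => ?_⟩, ?_⟩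
  · by_cases h0 : p (e x) 0
    · exact Or.inl ((Nat.find_eq_zero _).2 h0)
    · right
      have hiff : ∀ j, p (e x) (j + 1) ↔ p x j := by
        intro j
        simp only [p, Function.iterate_succ, Function.comp, e.symm_apply_apply]
        refine or_congr_right ⟨fun h i => by simpa using h (i + 1), fun h i => ?_⟩
        rcases i with _ | i
        · exact fun hx => h0 (Or.inl hx)
        · simpa using h i
      rw [Nat.find_eq_iff]
      refine ⟨(hiff _).2 (Nat.find_spec (hp x)), ?_⟩
      rintro (_ | j) hj
      · exact h0
      · rw [hiff]
        exact Nat.find_min (hp x) (Nat.lt_of_succ_lt_succ hj)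
  · have h1 : μ {x | Nat.find (hp x) = 0} ≤ μ B := by
      refine measure_mono_ae ?_
      filter_upwards [hBae] with x hx h
      have h' : p x 0 := (Nat.find_eq_zero _).1 h
      rcases h' with h' | h'
      · exact h'
      · exact absurd hx (not_exists.2 h')
    refine h1.trans ?_
    have h2 : μ B ≤ (H : ENNReal)⁻¹ := by
      rw [ENNReal.le_inv_iff_mul_le, mul_comm]
      exact hBH
    refine h2.trans ?_
    rw [← ENNReal.ofReal_natCast, ← ENNReal.ofReal_inv_of_pos hH0]
    exact ENNReal.ofReal_le_ofReal (inv_le_of_inv_le₀ hε hH.le)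

end Marker
section Clock

variable {Ω : Type*} [MeasurableSpace Ω] {μ : Measure Ω} {T : Ω → Ω} {pos : Ω → ℕ}

lemma IsClock.measurableSet (h : IsClock T pos) (p : ℕ → Prop) : MeasurableSet {x | p (pos x)} :=
  h.1 (MeasurableSet.of_discrete (s := {n | p n}))

lemma IsClock.sub (h : IsClock T pos) (r : ℕ) : IsClock T (fun x => pos x - r) := by
  refine ⟨(measurable_from_nat (f := fun n => n - r)).comp h.1, fun x => ?_⟩
  have := h.2 x
  simp only
  omega

lemma IsClock.pos_iterate (h : IsClock T pos) {n : ℕ} {x : Ω}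
    (hx : ∀ j, 1 ≤ j → j ≤ n → pos (T^[j] x) ≠ 0) : ∀ j ≤ n, pos (T^[j] x) = pos x + j := by
  intro j
  induction j with
  | zero => simp
  | succ j ih =>
    intro hj
    have h1 := h.2 (T^[j] x)
    have h2 := hx (j + 1) (by omega) hj
    rw [Function.iterate_succ_apply'] at h2 ⊢
    have := ih (by omega)
    omega

lemma IsClock.measure_eq_le (h : IsClock T pos) (hT : MeasurePreserving T μ μ) (j : ℕ) :
    μ {x | pos x = j} ≤ μ {x | pos x = 0} := by
  induction j with
  | zero => rfl
  | succ j ih =>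
    refine le_trans ?_ ih
    rw [← hT.measure_preimage (h.measurableSet (fun n => n = j + 1)).nullMeasurableSet]
    refine measure_mono fun x hx => ?_
    have h1 := h.2 x
    have h2 : pos (T x) = j + 1 := hx
    change pos x = j
    omega

lemma IsClock.measure_lt_le (h : IsClock T pos) (hT : MeasurePreserving T μ μ) (m : ℕ) :
    μ {x | pos x < m} ≤ m * μ {x | pos x = 0} := by
  have : {x | pos x < m} = ⋃ j ∈ Finset.range m, {x | pos x = j} := by ext x; simp
  rw [this]
  refine (measure_biUnion_finset_le _ _).trans ?_
  refine (Finset.sum_le_sum fun j _ => h.measure_eq_le hT j).trans ?_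
  simp

lemma IsClock.measure_reset_le (h : IsClock T pos) (hT : MeasurePreserving T μ μ) (n : ℕ) :
    μ {x | ∃ j, 1 ≤ j ∧ j ≤ n ∧ pos (T^[j] x) = 0} ≤ n * μ {x | pos x = 0} := by
  have : {x | ∃ j, 1 ≤ j ∧ j ≤ n ∧ pos (T^[j] x) = 0} =
      ⋃ j ∈ Finset.Icc 1 n, T^[j] ⁻¹' {x | pos x = 0} := by
    ext x; simp [and_assoc]
  rw [this]
  refine (measure_biUnion_finset_le _ _).trans ?_
  rw [Finset.sum_congr rfl fun j _ =>
    measure_preimage_iterate hT j (h.measurableSet (fun n => n = 0))]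
  simp

lemma lintegral_eq_sum_mod (hpos : Measurable pos) {h : Ω → ENNReal} {m : ℕ} (hm : 0 < m) :
    ∫⁻ x, h x ∂μ = ∑ r ∈ Finset.range m, ∫⁻ x in {x | pos x % m = r}, h x ∂μ := by
  rw [← lintegral_biUnion_finset]
  · have : (⋃ r ∈ Finset.range m, {x | pos x % m = r}) = univ := by
      ext x; simp [Nat.mod_lt _ hm]
    rw [this, setLIntegral_univ]
  · intro i _ j _ hij
    refine Set.disjoint_left.2 fun x hx hy => hij ?_
    exact Eq.trans (Eq.symm hx) hy
  · intro r _
    exact hpos (MeasurableSet.of_discrete (s := {n | n % m = r}))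

lemma exists_clock_offset [StandardBorelSpace Ω] [IsProbabilityMeasure μ] (e : Ω ≃ᵐ Ω)
    (he : MeasurePreserving e μ μ) (haper : μ {x | ∃ n ≥ 1, e^[n] x = x} = 0) {ε : ℝ}
    (hε : 0 < ε) {m : ℕ} (hm : 0 < m) (h : Ω → ENNReal) :
    ∃ pos, IsClock e pos ∧ μ {x | pos x = 0} ≤ ENNReal.ofReal ε ∧
      m * ∫⁻ x in {x | m ∣ pos x ∧ m ≤ pos x}, h x ∂μ ≤ ∫⁻ x, h x ∂μ := by
  have hm' : (0 : ℝ) < m := by exact_mod_cast hm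
  obtain ⟨pos, hpos, h0⟩ := exists_clock e he haper (div_pos hε hm')
  obtain ⟨r, hr, hmin⟩ := Finset.exists_min_image (Finset.range m)
    (fun r => ∫⁻ x in {x | pos x % m = r}, h x ∂μ) ⟨0, Finset.mem_range.2 hm⟩
  have hr' := Finset.mem_range.1 hr
  refine ⟨fun x => pos x - r, hpos.sub r, ?_, ?_⟩
  · have h1 : μ {x | pos x - r = 0} ≤ μ {x | pos x < m} := by
      refine measure_mono fun x hx => ?_
      have : pos x - r = 0 := hx
      change pos x < m
      omega
    refine (h1.trans (hpos.measure_lt_le he m)).trans ?_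
    refine (mul_le_mul_right h0 _).trans ?_
    rw [← ENNReal.ofReal_natCast, ← ENNReal.ofReal_mul hm'.le, mul_div_cancel₀ _ hm'.ne']
  · have h1 : ∫⁻ x in {x | m ∣ pos x - r ∧ m ≤ pos x - r}, h x ∂μ ≤
        ∫⁻ x in {x | pos x % m = r}, h x ∂μ := by
      refine lintegral_mono_set fun x hx => ?_
      obtain ⟨⟨k, hk⟩, hx2⟩ := hx
      change pos x % m = r
      have : pos x = r + m * k := by omega
      rw [this, Nat.add_mul_mod_self_left, Nat.mod_eq_of_lt hr']
    refine (mul_le_mul_right h1 _).trans ?_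
    rw [lintegral_eq_sum_mod (h := h) (μ := μ) hpos.1 hm]
    have := Finset.card_nsmul_le_sum (Finset.range m)
      (fun r => ∫⁻ x in {x | pos x % m = r}, h x ∂μ) _ hmin
    simpa using this

lemma IsClock.measure_phase_succ_le [IsProbabilityMeasure μ] (h : IsClock T pos)
    (hT : MeasurePreserving T μ μ) {ε : ℝ} (h0 : μ.real {x | pos x = 0} ≤ ε) {w b : ℕ}
    (hw : 0 < w) (l : ℕ) :
    μ.real {x | (pos x / w) % b = (l + 1) % b} ≤ μ.real {x | (pos x / w) % b = l % b} + w * ε := by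
  have h1 : μ.real {x | (pos x / w) % b = (l + 1) % b} =
      μ.real (T^[w] ⁻¹' {x | (pos x / w) % b = (l + 1) % b}) := by
    rw [measureReal_def, measureReal_def,
      measure_preimage_iterate hT _ (h.measurableSet (fun n => (n / w) % b = (l + 1) % b))]
  have h2 : μ.real {x | ∃ j, 1 ≤ j ∧ j ≤ w ∧ pos (T^[j] x) = 0} ≤ w * ε := by
    have := ENNReal.toReal_mono (by finiteness) (h.measure_reset_le hT w)
    rw [ENNReal.toReal_mul, ENNReal.toReal_natCast] at this
    exact this.trans (by gcongr; exact h0)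
  rw [h1]
  refine (measureReal_mono (s₂ := {x | (pos x / w) % b = l % b} ∪
    {x | ∃ j, 1 ≤ j ∧ j ≤ w ∧ pos (T^[j] x) = 0}) ?_).trans
    ((measureReal_union_le _ _).trans (by gcongr))
  intro x hx
  by_cases hr : ∃ j, 1 ≤ j ∧ j ≤ w ∧ pos (T^[j] x) = 0
  · exact Or.inr hr
  · left
    push Not at hr
    have h3 := h.pos_iterate hr w le_rfl
    have h4 : (pos (T^[w] x) / w) % b = (l + 1) % b := hx
    rw [h3, Nat.add_div_right _ hw] at h4
    exact Nat.ModEq.add_right_cancel' 1 h4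

lemma IsClock.abs_measure_phase_sub_le [IsProbabilityMeasure μ] (h : IsClock T pos)
    (hT : MeasurePreserving T μ μ) {ε : ℝ} (h0 : μ.real {x | pos x = 0} ≤ ε) {w b : ℕ}
    (hw : 0 < w) {l : ℕ} (hl : l < b) :
    |μ.real {x | (pos x / w) % b = l} - 1 / b| ≤ b * (w * ε) := by
  have hε : 0 ≤ ε := measureReal_nonneg.trans h0
  have hb : (0 : ℝ) < b := by exact_mod_cast (by omega : 0 < b)
  set U : ℕ → ℝ := fun l => μ.real {x | (pos x / w) % b = l % b} with hU
  have hstep : ∀ l, U (l + 1) ≤ U l + w * ε := fun l => h.measure_phase_succ_le hT h0 hw l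
  have hadd : ∀ l j, U (l + j) ≤ U l + j * (w * ε) := by
    intro l j
    induction j with
    | zero => simp
    | succ j ih =>
      have := hstep (l + j)
      push_cast
      rw [← add_assoc]
      linarith
  have hcmp : ∀ l < b, ∀ l' < b, U l' ≤ U l + b * (w * ε) := by
    intro l hl l' hl'
    rcases le_total l l' with hle | hle
    · have h1 := hadd l (l' - l)
      rw [Nat.add_sub_cancel' hle] at h1
      refine h1.trans ?_
      have : ((l' - l : ℕ) : ℝ) ≤ b := by exact_mod_cast (by omega)
      gcongr
    · have h1 := hadd l (b + l' - l)
      have h2 : U (l + (b + l' - l)) = U l' := by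
        simp only [hU]
        rw [show l + (b + l' - l) = l' + b by omega, Nat.add_mod_right]
      rw [h2] at h1
      refine h1.trans ?_
      have : ((b + l' - l : ℕ) : ℝ) ≤ b := by exact_mod_cast (by omega)
      gcongr
  have hsum : ∑ l ∈ Finset.range b, U l = 1 := by
    have h1 := lintegral_eq_sum_mod (μ := μ) (pos := fun x => pos x / w) (h := fun _ => 1)
      ((measurable_from_nat (f := fun n => n / w)).comp h.1) (m := b) (by omega)
    simp only [lintegral_const, MeasurableSet.univ, Measure.restrict_apply, univ_inter,
      one_mul, measure_univ] at h1
    have h2 := congrArg ENNReal.toReal h1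
    rw [ENNReal.toReal_sum (fun _ _ => by finiteness)] at h2
    rw [ENNReal.toReal_one] at h2
    rw [h2]
    refine Finset.sum_congr rfl fun l hl => ?_
    simp only [hU, Nat.mod_eq_of_lt (Finset.mem_range.1 hl), measureReal_def]
  have hUl : μ.real {x | (pos x / w) % b = l} = U l := by
    simp only [hU, Nat.mod_eq_of_lt hl]
  rw [hUl]
  have hlow : 1 ≤ b * (U l + b * (w * ε)) := by
    rw [← hsum]
    refine (Finset.sum_le_sum fun l' hl' => hcmp l hl l' (Finset.mem_range.1 hl')).trans ?_
    simp [mul_add]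
  have hup : b * U l ≤ 1 + b * (b * (w * ε)) := by
    have : ∑ l' ∈ Finset.range b, U l ≤ ∑ l' ∈ Finset.range b, (U l' + b * (w * ε)) :=
      Finset.sum_le_sum fun l' hl' => hcmp l' (Finset.mem_range.1 hl') l hl
    rw [Finset.sum_add_distrib, hsum] at this
    simpa using this
  rw [abs_le]
  constructor
  · have : 1 / (b : ℝ) ≤ U l + b * (w * ε) := by
      rw [div_le_iff₀ hb]; linarith
    linarith
  · have : U l - b * (w * ε) ≤ 1 / (b : ℝ) := by
      rw [le_div_iff₀ hb]; linarith
    linarith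

end Clock
section Recolor

/-- The number of letters `i` in a word `w`. -/
def letterCount {m : ℕ} (w : Fin m → ℕ) (i : ℕ) : ℕ := ∑ s, if w s = i then 1 else 0

lemma letterCount_update {m : ℕ} (w : Fin m → ℕ) (s : Fin m) (c i : ℕ) :
    letterCount (Function.update w s c) i + (if w s = i then 1 else 0) =
      letterCount w i + if c = i then 1 else 0 := by
  unfold letterCount
  rw [← Finset.add_sum_erase _ _ (Finset.mem_univ s),
    ← Finset.add_sum_erase (Finset.univ) (fun u => if w u = i then 1 else 0) (Finset.mem_univ s)]
  have : ∑ u ∈ Finset.univ.erase s, (if Function.update w s c u = i then 1 else 0) =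
      ∑ u ∈ Finset.univ.erase s, if w u = i then 1 else 0 := by
    refine Finset.sum_congr rfl fun u hu => ?_
    rw [Function.update_of_ne (Finset.ne_of_mem_erase hu)]
  rw [this, Function.update_self]
  omega

lemma exists_of_lt_letterCount {m : ℕ} {w : Fin m → ℕ} {i : ℕ} (h : 0 < letterCount w i) :
    ∃ s, w s = i := by
  by_contra! hne
  simp [letterCount, hne] at h

lemma sum_letterCount {m : ℕ} (w : Fin m → ℕ) (s : Finset ℕ) (h : ∀ u, w u ∈ s) :
    ∑ i ∈ s, letterCount w i = m := by
  unfold letterCount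
  rw [Finset.sum_comm]
  simp [h]

lemma exists_recolor {m K : ℕ} (q : ℕ → ℕ) (hq : ∑ i ∈ Finset.Icc 1 K, q i ≤ m) (N : ℕ) :
    ∀ w : Fin m → ℕ, (∀ s, w s ≤ K) →
      ∑ i ∈ Finset.Icc 1 K, Nat.dist (letterCount w i) (q i) ≤ N →
      ∃ w' : Fin m → ℕ, (∀ s, w' s ≤ K) ∧ (∀ i ∈ Finset.Icc 1 K, letterCount w' i = q i) ∧
        (∑ s, if w' s ≠ w s then 1 else 0) ≤ N := by
  induction N with
  | zero =>
    intro w hw hN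
    refine ⟨w, hw, fun i hi => Nat.eq_of_dist_eq_zero ?_, by simp⟩
    exact (Finset.sum_eq_zero_iff.1 (Nat.le_zero.1 hN)) i hi
  | succ N ih =>
    intro w hw hN
    suffices H : (∀ i ∈ Finset.Icc 1 K, letterCount w i = q i) ∨ ∃ s c, c ≤ K ∧
        ∑ i ∈ Finset.Icc 1 K, Nat.dist (letterCount (Function.update w s c) i) (q i) <
        ∑ i ∈ Finset.Icc 1 K, Nat.dist (letterCount w i) (q i) by
      rcases H with H | ⟨s, c, hc, H⟩
      · exact ⟨w, hw, H, by simp⟩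
      · obtain ⟨w', h1, h2, h3⟩ := ih (Function.update w s c) (fun u => by
          by_cases hu : u = s
          · subst hu; simpa using hc
          · simpa [Function.update_of_ne hu] using hw u) (by omega)
        refine ⟨w', h1, h2, ?_⟩
        have : ∀ u, (if w' u ≠ w u then 1 else 0) ≤
            (if w' u ≠ Function.update w s c u then 1 else 0) + if u = s then 1 else 0 := by
          intro u
          by_cases hu : u = s
          · subst hu; split_ifs <;> simp_all
          · simp [Function.update_of_ne hu]
        refine (Finset.sum_le_sum fun u _ => this u).trans ?_
        rw [Finset.sum_add_distrib]
        simpa using h3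
    by_cases hA : ∃ i ∈ Finset.Icc 1 K, q i < letterCount w i
    · obtain ⟨i, hi, hlt⟩ := hA
      obtain ⟨s, hs⟩ := exists_of_lt_letterCount (show 0 < letterCount w i by omega)
      refine Or.inr ⟨s, 0, Nat.zero_le _, Finset.sum_lt_sum (fun j hj => ?_) ⟨i, hi, ?_⟩⟩
      · have := letterCount_update w s 0 j
        have hj1 := (Finset.mem_Icc.1 hj).1
        rw [if_neg (show ¬ 0 = j by omega), hs] at this
        by_cases hij : i = j
        · subst hij
          rw [if_pos rfl] at this
          simp only [Nat.dist]; omega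
        · rw [if_neg hij] at this
          simp only [Nat.dist]; omega
      · have := letterCount_update w s 0 i
        have hi1 := (Finset.mem_Icc.1 hi).1
        rw [if_neg (show ¬ 0 = i by omega), hs, if_pos rfl] at this
        simp only [Nat.dist]; omega
    · push Not at hA
      by_cases hB : ∀ i ∈ Finset.Icc 1 K, q i ≤ letterCount w i
      · exact Or.inl fun i hi => le_antisymm (hA i hi) (hB i hi)
      push Not at hB
      obtain ⟨i, hi, hlt⟩ := hB
      have hs : ∃ s, w s = 0 := by
        by_contra! hne
        have h1 := sum_letterCount w (Finset.Icc 1 K)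
          (fun u => Finset.mem_Icc.2 ⟨Nat.one_le_iff_ne_zero.2 (hne u), hw u⟩)
        have h2 := Finset.sum_lt_sum hA ⟨i, hi, hlt⟩
        omega
      obtain ⟨s, hs⟩ := hs
      refine Or.inr ⟨s, i, (Finset.mem_Icc.1 hi).2, Finset.sum_lt_sum (fun j hj => ?_) ⟨i, hi, ?_⟩⟩
      · have := letterCount_update w s i j
        have hj1 := (Finset.mem_Icc.1 hj).1
        rw [hs, if_neg (show ¬ 0 = j by omega)] at this
        by_cases hij : i = j
        · subst hij
          rw [if_pos rfl] at this
          simp only [Nat.dist]; omega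
        · rw [if_neg hij] at this
          simp only [Nat.dist]; omega
      · have := letterCount_update w s i i
        have hi1 := (Finset.mem_Icc.1 hi).1
        rw [hs, if_neg (show ¬ 0 = i by omega), if_pos rfl] at this
        simp only [Nat.dist]; omega

end Recolor

section Coloring

variable {Ω : Type*}

/-- The number of visits of `x, T x, …, T^{n-1} x` to the colour class `i` of `f`. -/
def visitCount (T : Ω → Ω) (f : Ω → ℕ) (i n : ℕ) (x : Ω) : ℕ :=
  ∑ u ∈ Finset.range n, if f (T^[u] x) = i then 1 else 0

lemma visitCount_add (T : Ω → Ω) (f : Ω → ℕ) (i n n' : ℕ) (x : Ω) :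
    visitCount T f i (n + n') x = visitCount T f i n x + visitCount T f i n' (T^[n] x) := by
  unfold visitCount
  rw [Finset.sum_range_add]
  congr 1
  refine Finset.sum_congr rfl fun u _ => ?_
  rw [← Function.iterate_add_apply, Nat.add_comm u n]

lemma visitCount_le (T : Ω → Ω) (f : Ω → ℕ) (i n : ℕ) (x : Ω) : visitCount T f i n x ≤ n := by
  unfold visitCount
  refine (Finset.sum_le_sum (g := fun _ => 1) fun u _ => by split_ifs <;> simp).trans (by simp)

lemma sum_visitCount_le (T : Ω → Ω) (f : Ω → ℕ) (s : Finset ℕ) (n : ℕ) (x : Ω) :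
    ∑ i ∈ s, visitCount T f i n x ≤ n := by
  unfold visitCount
  rw [Finset.sum_comm]
  refine (Finset.sum_le_sum (g := fun _ => 1) fun u _ => ?_).trans (by simp)
  rw [Finset.sum_ite_eq]
  split_ifs <;> simp

lemma letterCount_orbit (T : Ω → Ω) (f : Ω → ℕ) (i m : ℕ) (x : Ω) :
    letterCount (fun u : Fin m => f (T^[u] x)) i = visitCount T f i m x := by
  unfold letterCount visitCount
  exact Fin.sum_univ_eq_sum_range (fun u => if f (T^[u] x) = i then 1 else 0) m

lemma measurable_visitCount [MeasurableSpace Ω] {T : Ω → Ω} (hT : Measurable T) {f : Ω → ℕ}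
    (hf : Measurable f) (i n : ℕ) : Measurable (visitCount T f i n) := by
  unfold visitCount
  refine Finset.measurable_fun_sum _ fun u _ => ?_
  exact (measurable_from_nat (f := fun c => if c = i then 1 else 0)).comp (hf.comp (hT.iterate u))

variable [MeasurableSpace Ω] {μ : Measure Ω}

lemma exists_recoloring (e : Ω ≃ᵐ Ω) (he : MeasurePreserving e μ μ) {f pos : Ω → ℕ}
    (hf : Measurable f) (hpos : IsClock e pos) {K m : ℕ} (hm : 0 < m) (hfK : ∀ x, f x ≤ K)
    (q : ℕ → ℕ → ℕ) (hq : ∀ t, ∑ i ∈ Finset.Icc 1 K, q i t ≤ m) :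
    ∃ f' : Ω → ℕ, Measurable f' ∧ (∀ x, f' x ≤ K) ∧
      (∀ x, m ∣ pos x → m ≤ pos x → (∀ j, 1 ≤ j → j ≤ m - 1 → pos (e^[j] x) ≠ 0) →
        ∀ i ∈ Finset.Icc 1 K, visitCount e f' i m x = q i (pos x / m)) ∧
      μ {x | f' x ≠ f x} ≤ μ {x | pos x < m} + ∫⁻ x in {x | m ∣ pos x ∧ m ≤ pos x},
        ((∑ i ∈ Finset.Icc 1 K, Nat.dist (visitCount e f i m x) (q i (pos x / m)) : ℕ) :
          ENNReal) ∂μ := by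
  classical
  have hrec : ∀ t (w : Fin m → ℕ), ∃ w' : Fin m → ℕ, (∀ s, w s ≤ K) → (∀ s, w' s ≤ K) ∧
      (∀ i ∈ Finset.Icc 1 K, letterCount w' i = q i t) ∧
      (∑ s, if w' s ≠ w s then 1 else 0) ≤
        ∑ i ∈ Finset.Icc 1 K, Nat.dist (letterCount w i) (q i t) := by
    intro t w
    by_cases hw : ∀ s, w s ≤ K
    · obtain ⟨w', h⟩ := exists_recolor (fun i => q i t) (hq t) _ w hw le_rfl
      exact ⟨w', fun _ => h⟩
    · exact ⟨w, fun h => absurd h hw⟩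
  choose W hW using hrec
  let word : Ω → Fin m → ℕ := fun y u => f (e^[u] y)
  have hword : Measurable word :=
    measurable_pi_lambda _ fun u => hf.comp (e.measurable.iterate u)
  have hwK : ∀ y s, word y s ≤ K := fun y s => hfK _
  let f' : Ω → ℕ := fun x => if pos x < m then f x else
    W (pos x / m) (word (e.symm^[pos x % m] x)) ⟨pos x % m, Nat.mod_lt _ hm⟩
  have hf'm : Measurable f' := by
    refine Measurable.ite (hpos.measurableSet (fun n => n < m)) hf ?_
    have h1 : Measurable fun (z : ℕ × Ω) =>
        W (z.1 / m) (word (e.symm^[z.1 % m] z.2)) ⟨z.1 % m, Nat.mod_lt _ hm⟩ := by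
      refine measurable_from_prod_countable_right fun n => ?_
      have h2 : Measurable fun w : Fin m → ℕ => W (n / m) w ⟨n % m, Nat.mod_lt _ hm⟩ :=
        Measurable.of_discrete
      exact h2.comp (hword.comp (e.symm.measurable.iterate (n % m)))
    exact h1.comp (hpos.1.prodMk measurable_id)
  have hback : ∀ s x, pos x % m = s → pos (e.symm^[s] x) = pos x - s := by
    have : ∀ s x, s ≤ pos x → pos (e.symm^[s] x) = pos x - s := by
      intro s
      induction s with
      | zero => simp
      | succ s ih =>
        intro x hx
        rw [Function.iterate_succ_apply]
        have h1 := hpos.2 (e.symm x)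
        rw [e.apply_symm_apply] at h1
        rw [ih _ (by omega)]
        omega
    exact fun s x hs => this s x (hs ▸ Nat.mod_le _ _)
  refine ⟨f', hf'm, ?_, ?_, ?_⟩
  · intro x
    simp only [f']
    split_ifs
    · exact hfK x
    · exact (hW _ _ (hwK _)).1 _
  · intro x hdvd hle hres i hi
    rw [← (hW (pos x / m) (word x) (hwK x)).2.1 i hi]
    unfold letterCount visitCount
    rw [← Fin.sum_univ_eq_sum_range (fun u => if f' (e^[u] x) = i then 1 else 0) m]
    refine Finset.sum_congr rfl fun u _ => ?_
    have hp := hpos.pos_iterate hres u (by omega)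
    obtain ⟨t, ht⟩ := hdvd
    have h1 : pos (e^[u] x) % m = u := by
      rw [hp, ht, Nat.mul_add_mod_self_left, Nat.mod_eq_of_lt u.2]
    have h2 : pos (e^[u] x) / m = pos x / m := by
      rw [hp, ht, Nat.mul_add_div hm, Nat.div_eq_of_lt u.2, Nat.mul_div_cancel_left _ hm, add_zero]
    have h3 : f' (e^[u] x) = W (pos x / m) (word x) u := by
      simp only [f']
      rw [if_neg (by omega)]
      simp only [h1, h2, iterate_symm_iterate]
    rw [h3]
  · let D : Set Ω := {x | m ∣ pos x ∧ m ≤ pos x}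
    let E : Fin m → Set Ω := fun s => D ∩ {y | W (pos y / m) (word y) s ≠ word y s}
    have hDm : MeasurableSet D := hpos.measurableSet (fun n => m ∣ n ∧ m ≤ n)
    have hEm : ∀ s, MeasurableSet {y | W (pos y / m) (word y) s ≠ word y s} := by
      intro s
      have h1 : Measurable fun z : ℕ × (Fin m → ℕ) => W (z.1 / m) z.2 s := Measurable.of_discrete
      refine (measurableSet_eq_fun (h1.comp (hpos.1.prodMk hword))
        ((measurable_pi_apply s).comp hword)).compl
    have hsub : {x | f' x ≠ f x} ⊆ {x | pos x < m} ∪ ⋃ s : Fin m, e.symm^[s] ⁻¹' (E s) := by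
      intro x hx
      by_cases hlt : pos x < m
      · exact Or.inl hlt
      right
      refine mem_iUnion.2 ⟨⟨pos x % m, Nat.mod_lt _ hm⟩, ?_⟩
      have hb := hback _ x rfl
      have hdm := Nat.div_add_mod (pos x) m
      have hb' : pos (e.symm^[pos x % m] x) = m * (pos x / m) := by omega
      have hge : 1 ≤ pos x / m := (Nat.one_le_div_iff hm).2 (not_lt.1 hlt)
      refine ⟨⟨⟨_, hb'⟩, ?_⟩, ?_⟩
      · change m ≤ pos (e.symm^[pos x % m] x)
        rw [hb']
        exact Nat.le_mul_of_pos_right m hge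
      · change W (pos (e.symm^[pos x % m] x) / m) (word (e.symm^[pos x % m] x))
          ⟨pos x % m, Nat.mod_lt _ hm⟩ ≠ word (e.symm^[pos x % m] x) ⟨pos x % m, Nat.mod_lt _ hm⟩
        rw [hb', Nat.mul_div_cancel_left _ hm]
        have h1 : f' x ≠ f x := hx
        simp only [f', if_neg hlt] at h1
        simp only [word, iterate_iterate_symm] at h1 ⊢
        exact h1
    refine (measure_mono hsub).trans ((measure_union_le _ _).trans ?_)
    gcongr
    refine (measure_iUnion_le _).trans ?_
    rw [tsum_fintype]
    have h1 : ∀ s : Fin m, μ (e.symm^[s] ⁻¹' (E s)) =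
        ∫⁻ x in D, ((if W (pos x / m) (word x) s ≠ word x s then 1 else 0 : ℕ) : ENNReal) ∂μ := by
      intro s
      rw [measure_preimage_iterate (he.symm e) _ (hDm.inter (hEm s)), inter_comm,
        ← Measure.restrict_apply (hEm s), ← lintegral_indicator_one (hEm s)]
      refine lintegral_congr fun x => ?_
      by_cases hx : W (pos x / m) (word x) s ≠ word x s
      · simp [Set.indicator, hx]
      · simp [Set.indicator, not_not.1 hx]
    rw [Finset.sum_congr rfl fun s _ => h1 s, ← lintegral_finsetSum]
    · refine lintegral_mono fun x => ?_
      rw [← Nat.cast_sum]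
      refine Nat.cast_le.2 ?_
      simp only [← letterCount_orbit]
      exact (hW (pos x / m) (word x) (hwK x)).2.2
    · intro s _
      refine (measurable_from_nat (f := fun n => (n : ENNReal))).comp ?_
      exact Measurable.ite (hEm s) measurable_const measurable_const

lemma visitCount_blocks {T : Ω → Ω} {f pos : Ω → ℕ} (hpos : IsClock T pos) {m i : ℕ} (hm : 0 < m)
    {q : ℕ → ℕ}
    (hblock : ∀ x, m ∣ pos x → m ≤ pos x → (∀ j, 1 ≤ j → j ≤ m - 1 → pos (T^[j] x) ≠ 0) →
        visitCount T f i m x = q (pos x / m)) (L : ℕ) {x : Ω} (hdvd : m ∣ pos x)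
    (hle : m ≤ pos x) (hres : ∀ j, 1 ≤ j → j ≤ L * m - 1 → pos (T^[j] x) ≠ 0) :
    visitCount T f i (L * m) x = ∑ u ∈ Finset.range L, q (pos x / m + u) := by
  induction L with
  | zero => simp [visitCount]
  | succ L ih =>
    have hmul : (L + 1) * m = L * m + m := by ring
    rw [Finset.sum_range_succ, hmul, visitCount_add,
      ih fun j h1 h2 => hres j h1 (by omega)]
    congr 1
    have hp := hpos.pos_iterate hres (L * m) (by omega)
    have h1 : pos (T^[L * m] x) / m = pos x / m + L := by
      rw [hp, Nat.add_mul_div_right _ _ hm]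
    rw [hblock, h1]
    · rw [hp]; exact Dvd.dvd.add hdvd (Nat.dvd_mul_left m L)
    · omega
    · intro j hj1 hj2
      rw [← Function.iterate_add_apply]
      exact hres _ (by omega) (by omega)

lemma dist_visitCount_window_le {T : Ω → Ω} {f pos : Ω → ℕ} (hpos : IsClock T pos) {m i : ℕ}
    (hm : 0 < m) {q : ℕ → ℕ} (hq : ∀ t, q t ≤ m)
    (hblock : ∀ x, m ∣ pos x → m ≤ pos x → (∀ j, 1 ≤ j → j ≤ m - 1 → pos (T^[j] x) ≠ 0) →
        visitCount T f i m x = q (pos x / m)) {L : ℕ} (hL : 0 < L) {x : Ω}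
    (hle : m ≤ pos x) (hres : ∀ j, 1 ≤ j → j ≤ L * m → pos (T^[j] x) ≠ 0) :
    Nat.dist (visitCount T f i (L * m) x) (∑ u ∈ Finset.range L, q (pos x / m + u)) ≤ m := by
  obtain ⟨L, rfl⟩ : ∃ k, L = k + 1 := ⟨L - 1, by omega⟩
  have hs := Nat.mod_lt (pos x) hm
  set s := pos x % m with hs'
  have hmul : (L + 1) * m = (m - s) + (L * m + s) := by
    rw [add_mul, one_mul]; omega
  have hp := hpos.pos_iterate hres (m - s) (by omega)
  have hdm := Nat.div_add_mod (pos x) m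
  have hp2 : pos (T^[m - s] x) = m * (pos x / m + 1) := by
    rw [hp, mul_add, mul_one]; omega
  have hmid := visitCount_blocks hpos hm hblock L (x := T^[m - s] x) ⟨_, hp2⟩ (by omega)
    (fun j h1 h2 => by
      rw [← Function.iterate_add_apply]
      exact hres _ (by omega) (by omega))
  rw [hp2, Nat.mul_div_cancel_left _ hm] at hmid
  rw [hmul, visitCount_add, visitCount_add, hmid, Finset.sum_range_succ']
  have h1 := visitCount_le T f i (m - s) x
  have h2 := visitCount_le T f i s (T^[L * m] (T^[m - s] x))
  have h3 := hq (pos x / m + 0)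
  have h4 : ∑ u ∈ Finset.range L, q (pos x / m + 1 + u) =
      ∑ u ∈ Finset.range L, q (pos x / m + (u + 1)) :=
    Finset.sum_congr rfl fun u _ => by rw [add_assoc, add_comm 1 u]
  rw [h4]
  simp only [Nat.dist]
  omega

end Coloring
section Levy

open ProbabilityTheory

variable {Ω : Type*} [MeasurableSpace Ω] {μ : Measure Ω} {ν : Measure ℝ}

/-- The law of `X` under `μ` is within `ε` of `ν` for the Lévy metric. -/
def LevyClose (μ : Measure Ω) (X : Ω → ℝ) (ν : Measure ℝ) (ε : ℝ) : Prop :=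
  ∀ t, cdf ν (t - ε) - ε ≤ μ.real {x | X x ≤ t} ∧ μ.real {x | X x ≤ t} ≤ cdf ν (t + ε) + ε

lemma LevyClose.levyDist_le [IsProbabilityMeasure μ] {X : Ω → ℝ} (hX : Measurable X) {ε : ℝ}
    (hε : 0 < ε) (h : LevyClose μ X ν ε) : levyDist (μ.map X) ν ≤ ε := by
  refine csInf_le ⟨0, fun _ hx => hx.1.le⟩ ⟨hε, fun t => ?_⟩
  have := Measure.isProbabilityMeasure_map (μ := μ) hX.aemeasurable
  rw [cdf_eq_real (μ.map X), map_measureReal_apply hX measurableSet_Iic]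
  exact h t

lemma LevyClose.perturb [IsProbabilityMeasure μ] {X X' : Ω → ℝ} {ε γ : ℝ}
    (h : LevyClose μ X ν ε) (hγ : μ.real {x | γ < |X x - X' x|} ≤ γ) :
    LevyClose μ X' ν (ε + γ) := by
  intro t
  have h1 : μ.real {x | X x ≤ t - γ} ≤ μ.real {x | X' x ≤ t} + γ := by
    refine (measureReal_mono (s₂ := {x | X' x ≤ t} ∪ {x | γ < |X x - X' x|}) ?_).trans
      ((measureReal_union_le _ _).trans (by gcongr))
    intro x hx
    by_cases hb : γ < |X x - X' x|
    · exact Or.inr hb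
    · left
      have hx' : X x ≤ t - γ := hx
      change X' x ≤ t
      linarith [(abs_le.1 (not_lt.1 hb)).1]
  have h2 : μ.real {x | X' x ≤ t} ≤ μ.real {x | X x ≤ t + γ} + γ := by
    refine (measureReal_mono (s₂ := {x | X x ≤ t + γ} ∪ {x | γ < |X x - X' x|}) ?_).trans
      ((measureReal_union_le _ _).trans (by gcongr))
    intro x hx
    by_cases hb : γ < |X x - X' x|
    · exact Or.inr hb
    · left
      have hx' : X' x ≤ t := hx
      change X x ≤ t + γ
      linarith [(abs_le.1 (not_lt.1 hb)).2]
  have h3 := (h (t - γ)).1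
  have h4 := (h (t + γ)).2
  rw [sub_sub, add_comm γ ε] at h3
  rw [add_assoc, add_comm γ ε] at h4
  constructor <;> linarith

lemma LevyClose.mono {X : Ω → ℝ} {ε ε' : ℝ} (h : LevyClose μ X ν ε) (hε : ε ≤ ε') :
    LevyClose μ X ν ε' := by
  intro t
  have h1 := monotone_cdf ν (show t - ε' ≤ t - ε by linarith)
  have h2 := monotone_cdf ν (show t + ε ≤ t + ε' by linarith)
  constructor <;> linarith [(h t).1, (h t).2]

lemma levyClose_dirac [IsProbabilityMeasure μ] (c : ℝ) :
    LevyClose μ (fun _ => c) (Measure.dirac c) 0 := by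
  intro t
  simp only [sub_zero, add_zero, cdf_eq_real]
  by_cases h : c ≤ t
  · simp [h, measureReal_def]
  · simp [h, measureReal_def]

/-- Every law is close to a uniform law on finitely many points whose barycentre is `0`. -/
lemma exists_centered_discretization (ν : Measure ℝ) [IsProbabilityMeasure ν] {ε : ℝ}
    (hε : 0 < ε) : ∃ b : ℕ, 0 < b ∧ ∃ v : ℕ → ℝ, ∑ l ∈ Finset.range b, v l = 0 ∧
      ∀ t, cdf ν (t - ε) - ε ≤ (((Finset.range b).filter fun l => v l ≤ t).card : ℝ) / b ∧
        (((Finset.range b).filter fun l => v l ≤ t).card : ℝ) / b ≤ cdf ν (t + ε) + ε := by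
  classical
  obtain ⟨b, hb⟩ := exists_nat_gt (ε⁻¹)
  have hb0 : (0 : ℝ) < b := lt_trans (inv_pos.2 hε) hb
  have hbε : 1 ≤ ε * b := by
    rw [inv_lt_iff_one_lt_mul₀ hε] at hb
    linarith
  have hbN : 0 < b := by exact_mod_cast hb0
  let Q : ℕ → ℝ := fun l => sInf {t | (l : ℝ) / b ≤ cdf ν t}
  let v : ℕ → ℝ := fun l => if l = 0 then - ∑ j ∈ Finset.Ico 1 b, Q j else Q l
  have hbdd : ∀ l : ℕ, 1 ≤ l → BddBelow {t | (l : ℝ) / b ≤ cdf ν t} := by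
    intro l hl
    have hpos : (0 : ℝ) < l / b := div_pos (by exact_mod_cast hl) hb0
    obtain ⟨c, hc⟩ := ((tendsto_cdf_atBot ν).eventually (gt_mem_nhds hpos)).exists
    refine ⟨c, fun t ht => ?_⟩
    by_contra! hlt
    have h1 : (l : ℝ) / b ≤ cdf ν t := ht
    linarith [monotone_cdf ν hlt.le]
  have hne : ∀ l : ℕ, l < b → {t | (l : ℝ) / b ≤ cdf ν t}.Nonempty := by
    intro l hl
    have hlt : (l : ℝ) / b < 1 := (div_lt_one hb0).2 (by exact_mod_cast hl)
    obtain ⟨c, hc⟩ := ((tendsto_cdf_atTop ν).eventually (lt_mem_nhds hlt)).exists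
    exact ⟨c, hc.le⟩
  refine ⟨b, hbN, v, ?_, fun t => ⟨?_, ?_⟩⟩
  · rw [Finset.range_eq_Ico, Finset.sum_eq_sum_Ico_succ_bot hbN]
    have : ∑ j ∈ Finset.Ico (0 + 1) b, v j = ∑ j ∈ Finset.Ico 1 b, Q j :=
      Finset.sum_congr rfl fun j hj => if_neg (by have := (Finset.mem_Ico.1 hj).1; omega)
    rw [this]
    simp [v]
  · have hF : cdf ν (t - ε) ≤ cdf ν t := monotone_cdf ν (by linarith)
    have hsub : Finset.Icc 1 (min (b - 1) ⌊b * cdf ν t⌋₊) ⊆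
        (Finset.range b).filter fun l => v l ≤ t := by
      intro l hl
      simp only [Finset.mem_Icc, le_min_iff] at hl
      obtain ⟨h1, h2, h3⟩ := hl
      refine Finset.mem_filter.2 ⟨Finset.mem_range.2 (by omega), ?_⟩
      simp only [v, if_neg (show l ≠ 0 by omega)]
      refine csInf_le (hbdd l h1) ?_
      change (l : ℝ) / b ≤ cdf ν t
      rw [div_le_iff₀' hb0]
      exact (Nat.le_floor_iff (mul_nonneg hb0.le (cdf_nonneg ν t))).1 h3
    have hcard := Finset.card_le_card hsub
    rw [Nat.card_Icc, Nat.add_sub_cancel] at hcard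
    have hcard' : ((min (b - 1) ⌊b * cdf ν t⌋₊ : ℕ) : ℝ) ≤
        ((Finset.range b).filter fun l => v l ≤ t).card := by exact_mod_cast hcard
    have hmin : b * cdf ν t - 1 ≤ ((min (b - 1) ⌊b * cdf ν t⌋₊ : ℕ) : ℝ) := by
      rw [Nat.cast_min, le_min_iff, Nat.cast_sub hbN, Nat.cast_one]
      constructor
      · nlinarith [cdf_le_one ν t]
      · linarith [Nat.lt_floor_add_one (b * cdf ν t)]
    rw [le_div_iff₀ hb0]
    nlinarith
  · have hsub : ((Finset.range b).filter fun l => v l ≤ t) ⊆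
        Finset.range (⌊b * cdf ν (t + ε)⌋₊ + 1) := by
      intro l hl
      obtain ⟨h1, h2⟩ := Finset.mem_filter.1 hl
      refine Finset.mem_range.2 (Nat.lt_succ_of_le ?_)
      rcases Nat.eq_zero_or_pos l with rfl | hl0
      · exact Nat.zero_le _
      simp only [v, if_neg (show l ≠ 0 by omega)] at h2
      obtain ⟨s, hs, hst⟩ := (csInf_lt_iff (hbdd l hl0) (hne l (Finset.mem_range.1 h1))).1
        (show Q l < t + ε by linarith)
      have hs' : (l : ℝ) / b ≤ cdf ν s := hs
      refine Nat.le_floor ?_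
      rw [div_le_iff₀' hb0] at hs'
      exact hs'.trans (by gcongr)
    have hcard := Finset.card_le_card hsub
    rw [Finset.card_range] at hcard
    have hcard' : (((Finset.range b).filter fun l => v l ≤ t).card : ℝ) ≤
        ⌊b * cdf ν (t + ε)⌋₊ + 1 := by exact_mod_cast hcard
    have := Nat.floor_le (mul_nonneg hb0.le (cdf_nonneg ν (t + ε)))
    rw [div_le_iff₀ hb0]
    nlinarith

lemma levyClose_of_discretization [IsProbabilityMeasure μ] {b : ℕ} {v : ℕ → ℝ} {ε κ : ℝ}
    (hv : ∀ t, cdf ν (t - ε) - ε ≤ (((Finset.range b).filter fun l => v l ≤ t).card : ℝ) / b ∧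
        (((Finset.range b).filter fun l => v l ≤ t).card : ℝ) / b ≤ cdf ν (t + ε) + ε)
    (hκ : 0 ≤ κ) {l : Ω → ℕ} (hl : Measurable l) (hlb : ∀ x, l x < b)
    (hμ : ∀ j < b, |μ.real {x | l x = j} - 1 / b| ≤ κ) :
    LevyClose μ (fun x => v (l x)) ν (ε + b * κ) := by
  intro t
  set S := (Finset.range b).filter fun l => v l ≤ t with hS
  have hset : {x | v (l x) ≤ t} = ⋃ j ∈ S, {x | l x = j} := by
    ext x
    simp [hS, hlb]
  have hmeas : μ.real {x | v (l x) ≤ t} = ∑ j ∈ S, μ.real {x | l x = j} := by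
    rw [hset, measureReal_biUnion_finset]
    · intro i _ j _ hij
      refine Set.disjoint_left.2 fun x hx hy => hij ?_
      exact Eq.trans (Eq.symm hx) hy
    · exact fun j _ => hl (measurableSet_singleton j)
  have hdiff : |μ.real {x | v (l x) ≤ t} - (S.card : ℝ) / b| ≤ b * κ := by
    have h1 : μ.real {x | v (l x) ≤ t} - (S.card : ℝ) / b =
        ∑ j ∈ S, (μ.real {x | l x = j} - 1 / b) := by
      rw [hmeas, Finset.sum_sub_distrib]
      simp [div_eq_mul_inv]
    rw [h1]
    refine (Finset.abs_sum_le_sum_abs _ _).trans ?_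
    refine (Finset.sum_le_sum fun j hj => hμ j
      (Finset.mem_range.1 (Finset.mem_filter.1 hj).1)).trans ?_
    rw [Finset.sum_const, nsmul_eq_mul]
    gcongr
    exact (Finset.card_filter_le _ _).trans (by simp)
  rw [abs_le] at hdiff
  have hbκ : 0 ≤ b * κ := by positivity
  have h2 := monotone_cdf ν (show t - (ε + b * κ) ≤ t - ε by linarith)
  have h3 := monotone_cdf ν (show t + ε ≤ t + (ε + b * κ) by linarith)
  constructor <;> linarith [(hv t).1, (hv t).2]

end Levy
section BlockPattern

lemma sum_range_add_of_periodic {f : ℕ → ℕ} {Q : ℕ} (hf : ∀ t, f (t + Q) = f t) (t : ℕ) :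
    ∑ u ∈ Finset.range Q, f (t + u) = ∑ u ∈ Finset.range Q, f u := by
  induction t with
  | zero => simp
  | succ t ih =>
    rw [← ih]
    have h1 := Finset.sum_range_succ (fun u => f (t + u)) Q
    have h2 := Finset.sum_range_succ' (fun u => f (t + u)) Q
    have h3 : ∑ u ∈ Finset.range Q, f (t + 1 + u) = ∑ u ∈ Finset.range Q, f (t + (u + 1)) :=
      Finset.sum_congr rfl fun u _ => by rw [add_assoc, add_comm 1 u]
    rw [h3]
    have h4 := hf t
    simp only [add_zero] at h2
    omega

lemma sum_range_mul_eq (f : ℕ → ℕ) (x y : ℕ) :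
    ∑ t ∈ Finset.range (x * y), f t =
      ∑ j ∈ Finset.range y, ∑ u ∈ Finset.range x, f (x * j + u) := by
  induction y with
  | zero => simp
  | succ y ih => rw [Finset.sum_range_succ, mul_add, mul_one, Finset.sum_range_add, ih]

lemma sum_range_ite_lt {z g : ℕ} (h : z ≤ g) :
    ∑ u ∈ Finset.range g, (if u < z then 1 else 0) = z := by
  rw [← Finset.sum_filter, Finset.sum_const, smul_eq_mul, mul_one]
  have : (Finset.range g).filter (fun u => u < z) = Finset.range z := by
    ext u; simp only [Finset.mem_filter, Finset.mem_range]; omega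
  rw [this, Finset.card_range]

/-- A `0`-`1` sequence of period `g * c * b` made of `b` regimes of length `g * c`: in the `l`-th
one, each run of `g` terms has `z l` ones. -/
def blockPattern (z : ℕ → ℕ) (g c b t : ℕ) : ℕ := if t % g < z (t / (g * c) % b) then 1 else 0

variable {z : ℕ → ℕ} {g c b : ℕ}

lemma blockPattern_le_one (t : ℕ) : blockPattern z g c b t ≤ 1 := by
  unfold blockPattern; split_ifs <;> simp

lemma blockPattern_periodic (hg : 0 < g) (hc : 0 < c) (t : ℕ) :
    blockPattern z g c b (t + g * c * b) = blockPattern z g c b t := by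
  unfold blockPattern
  rw [Nat.add_mul_div_left _ _ (Nat.mul_pos hg hc), Nat.add_mod_right, mul_assoc,
    Nat.add_mul_mod_self_left]

lemma sum_blockPattern_window (hz : ∀ l, z l ≤ g) (t : ℕ) (ht : t / g % c ≠ c - 1) (hg : 0 < g)
    (hc : 0 < c) :
    ∑ u ∈ Finset.range g, blockPattern z g c b (t + u) = z (t / (g * c) % b) := by
  have hdiv : ∀ u ∈ Finset.range g, (t + u) / (g * c) = t / (g * c) := by
    intro u hu
    have hu := Finset.mem_range.1 hu
    rw [← Nat.div_div_eq_div_mul, ← Nat.div_div_eq_div_mul]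
    have h1 : t / g ≤ (t + u) / g := Nat.div_le_div_right (by omega)
    have h2 : (t + u) / g ≤ t / g + 1 := by
      rw [← Nat.add_div_right _ hg]
      exact Nat.div_le_div_right (by omega)
    have h3 := Nat.mod_lt (t / g) hc
    have h4 := Nat.div_add_mod (t / g) c
    refine le_antisymm ?_ (Nat.div_le_div_right h1)
    refine Nat.le_of_lt_succ ((Nat.div_lt_iff_lt_mul hc).2 ?_)
    rw [Nat.succ_mul, mul_comm]
    omega
  have h1 : ∀ u ∈ Finset.range g, blockPattern z g c b (t + u) =
      (fun u => if u % g < z (t / (g * c) % b) then 1 else 0) (t + u) := by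
    intro u hu
    simp only [blockPattern, hdiv u hu]
  rw [Finset.sum_congr rfl h1,
    sum_range_add_of_periodic (f := fun u => if u % g < z (t / (g * c) % b) then 1 else 0)
      (fun t => by simp)]
  rw [← sum_range_ite_lt (hz (t / (g * c) % b))]
  refine Finset.sum_congr rfl fun u hu => ?_
  simp only [Nat.mod_eq_of_lt (Finset.mem_range.1 hu), sum_range_ite_lt (hz _)]

lemma sum_blockPattern (hz : ∀ l, z l ≤ g) (hg : 0 < g) (hc : 0 < c) :
    ∑ t ∈ Finset.range (g * c * b), blockPattern z g c b t = c * ∑ l ∈ Finset.range b, z l := by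
  rw [sum_range_mul_eq, Finset.mul_sum]
  refine Finset.sum_congr rfl fun l hl => ?_
  rw [sum_range_mul_eq]
  have : ∀ s ∈ Finset.range c, ∑ u ∈ Finset.range g,
      blockPattern z g c b (g * c * l + (g * s + u)) = z l := by
    intro s hs
    rw [← sum_range_ite_lt (hz l)]
    refine Finset.sum_congr rfl fun u hu => ?_
    have hu := Finset.mem_range.1 hu
    have hs := Finset.mem_range.1 hs
    have h1 : (g * c * l + (g * s + u)) % g = u := by
      rw [mul_assoc, Nat.mul_add_mod_self_left, Nat.mul_add_mod_self_left, Nat.mod_eq_of_lt hu]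
    have h2 : g * s + u < g * c :=
      calc g * s + u < g * (s + 1) := by rw [mul_add, mul_one]; omega
        _ ≤ g * c := Nat.mul_le_mul_left _ hs
    have h3 : (g * c * l + (g * s + u)) / (g * c) % b = l := by
      rw [Nat.mul_add_div (Nat.mul_pos hg hc), Nat.div_eq_of_lt h2, add_zero,
        Nat.mod_eq_of_lt (Finset.mem_range.1 hl)]
    unfold blockPattern
    rw [h1, h3]
  rw [Finset.sum_congr rfl this]
  simp

end BlockPattern

section BalancedColoring

variable {Ω : Type*} [MeasurableSpace Ω] {μ : Measure Ω}

/-- The colour classes `1, …, K` of `f` have, in mean, about `p i` visits in a window of length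
`m`, up to a relative error `δ`. -/
def BalancedColoring (μ : Measure Ω) (T : Ω → Ω) (K : ℕ) (f : Ω → ℕ) (m : ℕ) (p : ℕ → ℕ)
    (δ : ℝ) : Prop :=
  Measurable f ∧ (∀ x, f x ≤ K) ∧ ∑ i ∈ Finset.Icc 1 K, p i < m ∧ 1 ≤ δ * m ∧
    ∫⁻ x, ((∑ i ∈ Finset.Icc 1 K, Nat.dist (visitCount T f i m x) (p i) : ℕ) : ENNReal) ∂μ ≤
      ENNReal.ofReal (δ * m)

lemma BalancedColoring.mono {T : Ω → Ω} {K : ℕ} {f : Ω → ℕ} {m : ℕ} {p : ℕ → ℕ} {δ δ' : ℝ}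
    (h : BalancedColoring μ T K f m p δ) (hδ : δ ≤ δ') : BalancedColoring μ T K f m p δ' := by
  obtain ⟨h1, h2, h3, h4, h5⟩ := h
  have : δ * m ≤ δ' * m := by gcongr
  exact ⟨h1, h2, h3, h4.trans this, h5.trans (ENNReal.ofReal_le_ofReal this)⟩

lemma lintegral_visitCount {T : Ω → Ω} (hT : MeasurePreserving T μ μ) {f : Ω → ℕ}
    (hf : Measurable f) (i m : ℕ) :
    ∫⁻ x, (visitCount T f i m x : ENNReal) ∂μ = m * μ {x | f x = i} := by
  have hm : MeasurableSet {x | f x = i} := hf (measurableSet_singleton i)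
  have h1 : ∀ x, (visitCount T f i m x : ENNReal) =
      ∑ u ∈ Finset.range m, (T^[u] ⁻¹' {x | f x = i}).indicator (1 : Ω → ENNReal) x := by
    intro x
    simp only [visitCount, Nat.cast_sum, Nat.cast_ite, Nat.cast_one, Nat.cast_zero]
    refine Finset.sum_congr rfl fun u _ => ?_
    by_cases h : f (T^[u] x) = i <;> simp [h]
  simp only [h1]
  rw [lintegral_finsetSum _ fun u _ =>
    measurable_one.indicator ((hT.measurable.iterate u) hm)]
  rw [Finset.sum_congr rfl fun u _ => (lintegral_indicator_one
    ((hT.measurable.iterate u) hm)).trans (measure_preimage_iterate hT u hm)]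
  simp

lemma BalancedColoring.abs_measure_sub_le [IsProbabilityMeasure μ] {T : Ω → Ω}
    (hT : MeasurePreserving T μ μ) {K : ℕ} {f : Ω → ℕ} {m : ℕ} {p : ℕ → ℕ} {δ : ℝ}
    (h : BalancedColoring μ T K f m p δ) {i : ℕ} (hi : i ∈ Finset.Icc 1 K) :
    |m * μ.real {x | f x = i} - p i| ≤ δ * m := by
  obtain ⟨h1, -, -, h4, h5⟩ := h
  have hδ : 0 ≤ δ * m := by linarith
  have hdist : ∫⁻ x, (Nat.dist (visitCount T f i m x) (p i) : ENNReal) ∂μ ≤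
      ENNReal.ofReal (δ * m) := by
    refine le_trans (lintegral_mono fun x => Nat.cast_le.2 ?_) h5
    exact Finset.single_le_sum (f := fun i => Nat.dist (visitCount T f i m x) (p i))
      (fun _ _ => Nat.zero_le _) hi
  have hmeas : Measurable fun x => (visitCount T f i m x : ENNReal) :=
    (measurable_from_nat (f := fun n => (n : ENNReal))).comp
      (measurable_visitCount hT.measurable h1 i m)
  have hA : (m : ENNReal) * μ {x | f x = i} ≤ p i + ENNReal.ofReal (δ * m) := by
    rw [← lintegral_visitCount hT h1]
    calc ∫⁻ x, (visitCount T f i m x : ENNReal) ∂μ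
        ≤ ∫⁻ x, ((p i : ENNReal) + (Nat.dist (visitCount T f i m x) (p i) : ENNReal)) ∂μ := by
          refine lintegral_mono fun x => ?_
          rw [← Nat.cast_add]
          refine Nat.cast_le.2 ?_
          simp only [Nat.dist]; omega
      _ ≤ _ := by
          rw [lintegral_add_left measurable_const]
          rw [lintegral_const, measure_univ, mul_one]
          exact add_le_add_right hdist _
  have hB : (p i : ENNReal) ≤ m * μ {x | f x = i} + ENNReal.ofReal (δ * m) := by
    rw [← lintegral_visitCount hT h1]
    calc (p i : ENNReal) = ∫⁻ x, (p i : ENNReal) ∂μ := by simp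
      _ ≤ ∫⁻ x, ((visitCount T f i m x : ENNReal) +
            (Nat.dist (visitCount T f i m x) (p i) : ENNReal)) ∂μ := by
          refine lintegral_mono fun x => ?_
          rw [← Nat.cast_add]
          refine Nat.cast_le.2 ?_
          simp only [Nat.dist]; omega
      _ ≤ _ := by
          rw [lintegral_add_left hmeas]
          exact add_le_add_right hdist _
  have hA' := ENNReal.toReal_mono (by finiteness) hA
  have hB' := ENNReal.toReal_mono (by finiteness) hB
  rw [ENNReal.toReal_add (by finiteness) (by finiteness), ENNReal.toReal_mul,
    ENNReal.toReal_natCast, ENNReal.toReal_natCast, ENNReal.toReal_ofReal hδ] at hA' hB'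
  rw [abs_le, measureReal_def]
  constructor <;> linarith

lemma IsClock.measureReal_bad_le [IsProbabilityMeasure μ] {T : Ω → Ω} {pos : Ω → ℕ}
    (h : IsClock T pos) (hT : MeasurePreserving T μ μ) (m n : ℕ) {ρ : ℝ}
    (h0 : μ {x | pos x = 0} ≤ ENNReal.ofReal ρ) :
    μ {x | pos x < m ∨ ∃ j, 1 ≤ j ∧ j ≤ n ∧ pos (T^[j] x) = 0} ≤
      ENNReal.ofReal ((m + n) * ρ) := by
  have h1 := (h.measure_lt_le hT m).trans (mul_le_mul_right h0 _)
  have h2 := (h.measure_reset_le hT n).trans (mul_le_mul_right h0 _)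
  have h3 : μ {x | pos x < m ∨ ∃ j, 1 ≤ j ∧ j ≤ n ∧ pos (T^[j] x) = 0} ≤
      μ {x | pos x < m} + μ {x | ∃ j, 1 ≤ j ∧ j ≤ n ∧ pos (T^[j] x) = 0} := measure_union_le _ _
  refine (h3.trans (add_le_add h1 h2)).trans ?_
  rw [← add_mul, ← Nat.cast_add, ← ENNReal.ofReal_natCast, ← ENNReal.ofReal_mul (by positivity),
    Nat.cast_add]

/-- Recolouring along a clock so as to realise prescribed periodic block counts. -/
lemma BalancedColoring.exists_refinement [StandardBorelSpace Ω] [IsProbabilityMeasure μ]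
    (e : Ω ≃ᵐ Ω)
    (he : MeasurePreserving e μ μ) (haper : μ {x | ∃ n ≥ 1, e^[n] x = x} = 0)
    {K : ℕ} {f : Ω → ℕ} {m : ℕ} {p : ℕ → ℕ} {δ : ℝ} (h : BalancedColoring μ e K f m p δ)
    {χ : ℕ → ℕ} (hχ : ∀ t, χ t ≤ 1) {Q : ℕ} (hQ : ∀ t, χ (t + Q) = χ t)
    (hχ0 : ∃ t < Q, χ t = 0) {δ' : ℝ} (hδ' : 0 < δ') (hlarge : 2 * ((K + 1) * m) ≤ δ' * (m * Q))
    {ρ : ℝ} (hρ : 0 < ρ) :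
    ∃ f' pos : Ω → ℕ, IsClock e pos ∧ μ {x | pos x = 0} ≤ ENNReal.ofReal ρ ∧
      BalancedColoring μ e (K + 1) f' (m * Q)
        (fun i => if i = K + 1 then ∑ t ∈ Finset.range Q, χ t else Q * p i) δ' ∧
      μ {x | f' x ≠ f x} ≤ ENNReal.ofReal (3 * δ) ∧
      (∀ L, 0 < L → ∀ x, m ≤ pos x → (∀ j, 1 ≤ j → j ≤ L * m → pos (e^[j] x) ≠ 0) →
        Nat.dist (visitCount e f' (K + 1) (L * m) x)
          (∑ u ∈ Finset.range L, χ (pos x / m + u)) ≤ m ∧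
        ∀ i ∈ Finset.Icc 1 K, Nat.dist (visitCount e f' i (L * m) x) (L * p i) ≤ m) := by
  obtain ⟨hfm, hfK, hpm, hδm, hdist_le⟩ := h
  obtain ⟨t0, ht0, hχt0⟩ := hχ0
  have hm : 0 < m := by omega
  have hm' : (0 : ℝ) < m := by exact_mod_cast hm
  have hm1 : (1 : ℝ) ≤ m := by exact_mod_cast hm
  have hδ : 0 < δ := by
    by_contra! hneg
    linarith [mul_nonpos_of_nonpos_of_nonneg hneg hm'.le]
  have hQ0 : 0 < Q := by omega
  have hQ' : (0 : ℝ) < Q := by exact_mod_cast hQ0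
  set R : ℝ := m + m * Q with hR
  have hR0 : 0 < R := by positivity
  set ρ' := min ρ (min δ (δ' / 4) / R) with hρ'
  have hρ'0 : 0 < ρ' := by positivity
  have hRρ : R * ρ' ≤ min δ (δ' / 4) := by
    have : ρ' ≤ min δ (δ' / 4) / R := min_le_right _ _
    rwa [le_div_iff₀' hR0] at this
  have hRδ : R * ρ' ≤ δ := hRρ.trans (min_le_left _ _)
  have hRδ' : R * ρ' ≤ δ' / 4 := hRρ.trans (min_le_right _ _)
  obtain ⟨pos, hpos, hpos0, hoff⟩ := exists_clock_offset e he haper hρ'0 hm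
    (fun x => ((∑ i ∈ Finset.Icc 1 K, Nat.dist (visitCount e f i m x) (p i) : ℕ) : ENNReal) + 1)
  let q : ℕ → ℕ → ℕ := fun i t => if i = K + 1 then χ t else p i
  have hqK : ∀ t, q (K + 1) t = χ t := fun t => if_pos rfl
  have hqi : ∀ i ∈ Finset.Icc 1 K, ∀ t, q i t = p i := by
    intro i hi t
    have := (Finset.mem_Icc.1 hi).2
    exact if_neg (by omega)
  have hqsum : ∀ t, ∑ i ∈ Finset.Icc 1 (K + 1), q i t = ∑ i ∈ Finset.Icc 1 K, p i + χ t := by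
    intro t
    rw [Finset.sum_Icc_succ_top (by omega), hqK, Finset.sum_congr rfl fun i hi => hqi i hi t]
  have hqle : ∀ t, ∑ i ∈ Finset.Icc 1 (K + 1), q i t ≤ m := by
    intro t
    rw [hqsum]
    have := hχ t
    omega
  obtain ⟨f', hf'm, hf'K, hblock, hchange⟩ := exists_recoloring e he hfm hpos hm
    (fun x => (hfK x).trans (Nat.le_succ K)) q hqle
  have hwin : ∀ i ∈ Finset.Icc 1 (K + 1), ∀ L, 0 < L → ∀ x, m ≤ pos x →
      (∀ j, 1 ≤ j → j ≤ L * m → pos (e^[j] x) ≠ 0) →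
      Nat.dist (visitCount e f' i (L * m) x) (∑ u ∈ Finset.range L, q i (pos x / m + u)) ≤ m := by
    intro i hi L hL x h1 h2
    refine dist_visitCount_window_le hpos hm (q := q i) (fun t => ?_)
      (fun x h1 h2 h3 => hblock x h1 h2 h3 i hi) hL h1 h2
    exact (Finset.single_le_sum (f := fun i => q i t) (fun _ _ => Nat.zero_le _) hi).trans (hqle t)
  have hK1 : K + 1 ∈ Finset.Icc 1 (K + 1) := Finset.mem_Icc.2 ⟨by omega, le_rfl⟩
  have hKsub : ∀ i ∈ Finset.Icc 1 K, i ∈ Finset.Icc 1 (K + 1) := fun i hi =>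
    Finset.Icc_subset_Icc_right (Nat.le_succ K) hi
  refine ⟨f', pos, hpos, hpos0.trans (ENNReal.ofReal_le_ofReal (min_le_left _ _)), ?_, ?_, ?_⟩
  · set p' : ℕ → ℕ := fun i => if i = K + 1 then ∑ t ∈ Finset.range Q, χ t else Q * p i with hp'
    have hp'q : ∀ i ∈ Finset.Icc 1 (K + 1), ∀ t, ∑ u ∈ Finset.range Q, q i (t + u) = p' i := by
      intro i hi t
      by_cases hiK : i = K + 1
      · subst hiK
        simp only [hp', if_true, hqK]
        exact sum_range_add_of_periodic hQ t
      · simp [hp', q, hiK]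
    have hmQ : 1 ≤ δ' * ((m * Q : ℕ) : ℝ) := by
      push_cast
      have : (1 : ℝ) ≤ 2 * ((K + 1) * m) := by nlinarith [(Nat.cast_nonneg K : (0 : ℝ) ≤ K)]
      linarith
    have hp'sum : ∑ i ∈ Finset.Icc 1 (K + 1), p' i < m * Q := by
      have h1 : ∑ i ∈ Finset.Icc 1 (K + 1), p' i =
          ∑ t ∈ Finset.range Q, ∑ i ∈ Finset.Icc 1 (K + 1), q i t := by
        rw [Finset.sum_comm]
        refine Finset.sum_congr rfl fun i hi => ?_
        rw [← hp'q i hi 0]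
        simp
      rw [h1]
      have h2 : ∑ t ∈ Finset.range Q, ∑ i ∈ Finset.Icc 1 (K + 1), q i t <
          ∑ t ∈ Finset.range Q, m :=
        Finset.sum_lt_sum (fun t _ => hqle t) ⟨t0, Finset.mem_range.2 ht0, by
          rw [hqsum, hχt0]; omega⟩
      rw [Finset.sum_const, Finset.card_range, smul_eq_mul, mul_comm] at h2
      exact h2
    refine ⟨hf'm, hf'K, hp'sum, hmQ, ?_⟩
    set bad : Set Ω := {x | pos x < m ∨ ∃ j, 1 ≤ j ∧ j ≤ m * Q ∧ pos (e^[j] x) = 0} with hbad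
    have hbadm : MeasurableSet bad := by
      refine (hpos.measurableSet (fun n => n < m)).union ?_
      have : {x | ∃ j, 1 ≤ j ∧ j ≤ m * Q ∧ pos (e^[j] x) = 0} =
          ⋃ j ∈ Finset.Icc 1 (m * Q), e^[j] ⁻¹' {x | pos x = 0} := by
        ext x; simp [and_assoc]
      have h2 : MeasurableSet {x | ∃ j, 1 ≤ j ∧ j ≤ m * Q ∧ pos (e^[j] x) = 0} := by
        rw [this]
        exact Finset.measurableSet_biUnion _ fun j _ =>
          (e.measurable.iterate j) (hpos.measurableSet (fun n => n = 0))
      exact h2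
    have hpt : ∀ x, ((∑ i ∈ Finset.Icc 1 (K + 1),
        Nat.dist (visitCount e f' i (m * Q) x) (p' i) : ℕ) : ENNReal) ≤
        (((K + 1) * m : ℕ) : ENNReal) +
          bad.indicator (fun _ => ((2 * (m * Q) : ℕ) : ENNReal)) x := by
      intro x
      by_cases hx : x ∈ bad
      · rw [Set.indicator_of_mem hx]
        refine le_add_left (Nat.cast_le.2 ?_)
        have h1 : ∀ i ∈ Finset.Icc 1 (K + 1), Nat.dist (visitCount e f' i (m * Q) x) (p' i) ≤
            visitCount e f' i (m * Q) x + p' i := by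
          intro i _
          simp only [Nat.dist]; omega
        refine (Finset.sum_le_sum h1).trans ?_
        rw [Finset.sum_add_distrib]
        have := sum_visitCount_le e f' (Finset.Icc 1 (K + 1)) (m * Q) x
        omega
      · rw [Set.indicator_of_notMem hx, add_zero]
        refine Nat.cast_le.2 ?_
        have hx' : ¬ (pos x < m ∨ ∃ j, 1 ≤ j ∧ j ≤ m * Q ∧ pos (e^[j] x) = 0) := hx
        push Not at hx'
        have h1 : ∀ i ∈ Finset.Icc 1 (K + 1),
            Nat.dist (visitCount e f' i (m * Q) x) (p' i) ≤ m := by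
          intro i hi
          have := hwin i hi Q hQ0 x hx'.1 (by rw [mul_comm]; exact hx'.2)
          rwa [hp'q i hi, mul_comm] at this
        refine (Finset.sum_le_card_nsmul _ _ _ h1).trans ?_
        simp
    refine (lintegral_mono hpt).trans ?_
    rw [lintegral_add_left measurable_const, lintegral_indicator_const hbadm]
    have hb := hpos.measureReal_bad_le he m (m * Q) hpos0
    refine (add_le_add_right (mul_le_mul_right hb _) _).trans ?_
    rw [lintegral_const, measure_univ, mul_one, ← ENNReal.ofReal_natCast,
      ← ENNReal.ofReal_natCast (2 * (m * Q)), ← ENNReal.ofReal_mul (by positivity),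
      ← ENNReal.ofReal_add (by positivity) (by positivity)]
    refine ENNReal.ofReal_le_ofReal ?_
    push_cast
    have : 2 * ((m : ℝ) * Q) * ((m + m * Q) * ρ') ≤ 2 * (m * Q) * (δ' / 4) := by
      rw [← hR]; gcongr
    linarith
  · have hD : ∫⁻ x in {x | m ∣ pos x ∧ m ≤ pos x}, ((∑ i ∈ Finset.Icc 1 (K + 1),
        Nat.dist (visitCount e f i m x) (q i (pos x / m)) : ℕ) : ENNReal) ∂μ ≤
        ENNReal.ofReal (2 * δ) := by
      have h1 : ∫⁻ x in {x | m ∣ pos x ∧ m ≤ pos x}, ((∑ i ∈ Finset.Icc 1 (K + 1),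
          Nat.dist (visitCount e f i m x) (q i (pos x / m)) : ℕ) : ENNReal) ∂μ ≤
          ∫⁻ x in {x | m ∣ pos x ∧ m ≤ pos x}, (((∑ i ∈ Finset.Icc 1 K,
            Nat.dist (visitCount e f i m x) (p i) : ℕ) : ENNReal) + 1) ∂μ := by
        refine lintegral_mono fun x => ?_
        suffices h : ∑ i ∈ Finset.Icc 1 (K + 1), Nat.dist (visitCount e f i m x) (q i (pos x / m)) ≤
            ∑ i ∈ Finset.Icc 1 K, Nat.dist (visitCount e f i m x) (p i) + 1 from
          (Nat.cast_le.2 h).trans (by rw [Nat.cast_add, Nat.cast_one])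
        rw [Finset.sum_Icc_succ_top (by omega), hqK,
          Finset.sum_congr rfl fun i hi => by rw [hqi i hi]]
        have h2 : visitCount e f (K + 1) m x = 0 := by
          unfold visitCount
          refine Finset.sum_eq_zero fun u _ => if_neg ?_
          have := hfK (e^[u] x)
          omega
        have h3 := hχ (pos x / m)
        rw [h2]
        simp only [Nat.dist]; omega
      refine h1.trans ?_
      have h4 : (m : ENNReal) * ∫⁻ x in {x | m ∣ pos x ∧ m ≤ pos x}, (((∑ i ∈ Finset.Icc 1 K,
            Nat.dist (visitCount e f i m x) (p i) : ℕ) : ENNReal) + 1) ∂μ ≤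
            m * ENNReal.ofReal (2 * δ) := by
        refine hoff.trans ?_
        rw [lintegral_add_right _ measurable_const, lintegral_const, measure_univ, mul_one]
        refine (add_le_add_left hdist_le 1).trans ?_
        rw [← ENNReal.ofReal_one, ← ENNReal.ofReal_add (by linarith) zero_le_one,
          ← ENNReal.ofReal_natCast, ← ENNReal.ofReal_mul hm'.le]
        exact ENNReal.ofReal_le_ofReal (by linarith)
      exact (ENNReal.mul_le_mul_iff_right (by exact_mod_cast hm.ne') (by finiteness)).1 h4
    have h1 : μ {x | pos x < m} ≤ ENNReal.ofReal δ := by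
      refine (hpos.measure_lt_le he m).trans ((mul_le_mul_right hpos0 _).trans ?_)
      rw [← ENNReal.ofReal_natCast, ← ENNReal.ofReal_mul hm'.le]
      refine ENNReal.ofReal_le_ofReal (le_trans ?_ hRδ)
      have : (m : ℝ) ≤ R := by rw [hR]; nlinarith
      gcongr
    refine hchange.trans ((add_le_add h1 hD).trans ?_)
    rw [← ENNReal.ofReal_add hδ.le (by positivity)]
    exact ENNReal.ofReal_le_ofReal (by linarith)
  · intro L hL x h1 h2
    refine ⟨?_, fun i hi => ?_⟩
    · simpa only [hqK] using hwin _ hK1 L hL x h1 h2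
    · simpa [hqi i hi] using hwin i (hKsub i hi) L hL x h1 h2

end BalancedColoring

section Step

open ProbabilityTheory

lemma exists_scale {a : ℕ → ℝ} (ha_pos : ∀ n, 0 < a n) (ha_top : Tendsto a atTop atTop)
    (ha_small : Tendsto (fun n => a n / n) atTop (𝓝 0)) (ν : Measure ℝ) [IsProbabilityMeasure ν]
    {η : ℝ} (hη : 0 < η) {m : ℕ} (hm : 0 < m) (N : ℕ) :
    ∃ g b : ℕ, ∃ z : ℕ → ℕ, ∃ v : ℕ → ℝ, 0 < g ∧ 0 < b ∧ N ≤ g * m ∧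
      m + 4 ≤ η / 8 * a (g * m) ∧ (∀ l, z l < g) ∧
      (∀ l < b, |z l - (∑ l ∈ Finset.range b, (z l : ℝ)) / b - a (g * m) * v l| ≤ 2) ∧
      ∀ t, cdf ν (t - η / 4) - η / 4 ≤ (((Finset.range b).filter fun l => v l ≤ t).card : ℝ) / b ∧
        (((Finset.range b).filter fun l => v l ≤ t).card : ℝ) / b ≤ cdf ν (t + η / 4) + η / 4 := by
  obtain ⟨b, hb, v, hv0, hv⟩ := exists_centered_discretization ν (show 0 < η / 4 by positivity)
  set d : ℝ := ∑ l ∈ Finset.range b, |v l| with hd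
  have hd0 : 0 ≤ d := Finset.sum_nonneg fun _ _ => abs_nonneg _
  have hvd : ∀ l < b, |v l| ≤ d := fun l hl =>
    Finset.single_le_sum (f := fun l => |v l|) (fun _ _ => abs_nonneg _) (Finset.mem_range.2 hl)
  have hm' : (0 : ℝ) < m := by exact_mod_cast hm
  have hlim : Tendsto (fun g : ℕ => g * m) atTop atTop := tendsto_id.atTop_mul_const' hm
  have e1 := hlim.eventually (ha_top.eventually_ge_atTop ((m + 4) / (η / 8)))
  have e2 := hlim.eventually (ha_small.eventually_lt_const
    (show 0 < 1 / (m * (2 * d + 1)) by positivity))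
  obtain ⟨g, h1, h2, h3, h4⟩ := (e1.and (e2.and ((hlim.eventually_ge_atTop N).and
    (eventually_gt_atTop 0)))).exists
  have hg' : (0 : ℝ) < g := by exact_mod_cast h4
  have hb' : (0 : ℝ) < b := by exact_mod_cast hb
  have hA := ha_pos (g * m)
  set A := a (g * m) with hAdef
  have hAg : A * (2 * d) < g := by
    push_cast at h2
    rw [div_lt_div_iff₀ (by positivity) (by positivity), one_mul] at h2
    have : A * (2 * d + 1) < g := by
      by_contra! hc
      nlinarith [mul_le_mul_of_nonneg_right hc hm'.le]
    linarith
  have hz1 : ∀ l < b, (⌊A * (v l + d)⌋₊ : ℝ) ≤ A * (v l + d) := fun l hl =>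
    Nat.floor_le (mul_nonneg hA.le (by linarith [(abs_le.1 (hvd l hl)).1]))
  have hz2 : ∀ l, A * (v l + d) - 1 ≤ (⌊A * (v l + d)⌋₊ : ℝ) := fun l =>
    (Nat.sub_one_lt_floor _).le
  refine ⟨g, b, fun l => if l < b then ⌊A * (v l + d)⌋₊ else 0, v, h4, hb, h3, ?_, ?_, ?_, hv⟩
  · rwa [div_le_iff₀' (by positivity)] at h1
  · intro l
    dsimp only
    split_ifs with hl
    · have : (⌊A * (v l + d)⌋₊ : ℝ) < g := by
        refine (hz1 l hl).trans_lt (lt_of_le_of_lt ?_ hAg)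
        exact mul_le_mul_of_nonneg_left (by linarith [(abs_le.1 (hvd l hl)).2]) hA.le
      exact_mod_cast this
    · exact h4
  · have hsum : ∑ l ∈ Finset.range b, ((if l < b then ⌊A * (v l + d)⌋₊ else 0 : ℕ) : ℝ) =
        ∑ l ∈ Finset.range b, (⌊A * (v l + d)⌋₊ : ℝ) :=
      Finset.sum_congr rfl fun l hl => by rw [if_pos (Finset.mem_range.1 hl)]
    have htot : ∑ l ∈ Finset.range b, A * (v l + d) = b * (A * d) := by
      rw [← Finset.mul_sum, Finset.sum_add_distrib, hv0]
      simp
      ring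
    have hu : (∑ l ∈ Finset.range b, (⌊A * (v l + d)⌋₊ : ℝ)) / b ≤ A * d := by
      rw [div_le_iff₀' hb', ← htot]
      exact Finset.sum_le_sum fun l hl => hz1 l (Finset.mem_range.1 hl)
    have hl' : A * d - 1 ≤ (∑ l ∈ Finset.range b, (⌊A * (v l + d)⌋₊ : ℝ)) / b := by
      rw [le_div_iff₀' hb', mul_sub, ← htot, mul_one]
      calc _ = ∑ l ∈ Finset.range b, (A * (v l + d) - 1) := by simp [Finset.sum_sub_distrib]
        _ ≤ _ := Finset.sum_le_sum fun l _ => hz2 l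
    intro l hl
    dsimp only
    rw [hsum, if_pos hl, abs_le, ← hAdef]
    have i1 := hz1 l hl
    have i2 := hz2 l
    constructor <;> linarith

variable {Ω : Type*} [MeasurableSpace Ω] {μ : Measure Ω}

lemma Nat.abs_cast_sub_le_of_dist_le {p q r : ℕ} (h : Nat.dist p q ≤ r) :
    |(p : ℝ) - q| ≤ r := by
  simp only [Nat.dist] at h
  have h1 : (p : ℝ) ≤ q + r := by exact_mod_cast (by omega : p ≤ q + r)
  have h2 : (q : ℝ) ≤ p + r := by exact_mod_cast (by omega : q ≤ p + r)
  rw [abs_le]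
  constructor <;> linarith

set_option maxHeartbeats 1000000 in
lemma BalancedColoring.exists_levyClose [StandardBorelSpace Ω] [IsProbabilityMeasure μ]
    (e : Ω ≃ᵐ Ω) (he : MeasurePreserving e μ μ) (haper : μ {x | ∃ n ≥ 1, e^[n] x = x} = 0)
    {a : ℕ → ℝ} (ha_pos : ∀ n, 0 < a n) (ha_top : Tendsto a atTop atTop)
    (ha_small : Tendsto (fun n => a n / n) atTop (𝓝 0))
    {K : ℕ} {f : Ω → ℕ} {m : ℕ} {p : ℕ → ℕ} {δ : ℝ} (h : BalancedColoring μ e K f m p δ)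
    (ν : Measure ℝ) [IsProbabilityMeasure ν] {η : ℝ} (hη : 0 < η) (N : ℕ) :
    ∃ n, N ≤ n ∧ ∀ δ' > 0, ∃ f' m' p', BalancedColoring μ e (K + 1) f' m' p' δ' ∧
      μ {x | f' x ≠ f x} ≤ ENNReal.ofReal (3 * δ) ∧
      LevyClose μ (fun x => (a n)⁻¹ * (visitCount e f' (K + 1) n x - n * μ.real {x | f' x = K + 1}))
        ν η ∧
      ∀ i ∈ Finset.Icc 1 K,
        LevyClose μ (fun x => (a n)⁻¹ * (visitCount e f' i n x - n * μ.real {x | f' x = i}))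
          (Measure.dirac 0) η := by
  have hm : 0 < m := by
    have := h.2.2.1
    omega
  obtain ⟨g, b, z, v, hg, hb, hN, hA, hzg, hzv, hv⟩ :=
    exists_scale ha_pos ha_top ha_small ν hη hm N
  refine ⟨g * m, hN, fun δ' hδ' => ?_⟩
  set A := a (g * m) with hAdef
  have hA0 : 0 < A := ha_pos _
  have hm' : (0 : ℝ) < m := by exact_mod_cast hm
  have hg' : (0 : ℝ) < g := by exact_mod_cast hg
  have hb' : (0 : ℝ) < b := by exact_mod_cast hb
  set δ'' := min δ' (η * A / 8 / (g * m)) with hδ''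
  have hδ''0 : 0 < δ'' := by positivity
  have hδn : δ'' * (g * m) ≤ η * A / 8 := by
    have : δ'' ≤ η * A / 8 / (g * m) := min_le_right _ _
    rwa [le_div_iff₀ (by positivity)] at this
  obtain ⟨c, hc⟩ := exists_nat_gt (16 / η + 2 * ((K + 1) * m) / δ'')
  have hc1 : 16 / η < c := lt_of_le_of_lt (le_add_of_nonneg_right (by positivity)) hc
  have hc2 : 2 * ((K + 1) * m) / δ'' < c :=
    lt_of_le_of_lt (le_add_of_nonneg_left (by positivity)) hc
  have hc0' : (0 : ℝ) < c := lt_trans (by positivity) hc1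
  have hc0 : 0 < c := by exact_mod_cast hc0'
  have hcη : 1 / (c : ℝ) ≤ η / 16 := by
    rw [div_lt_iff₀ hη] at hc1
    rw [div_le_div_iff₀ hc0' (by norm_num)]
    linarith
  set M : ℝ := b * (b * (m * (g * c))) + c * (m * g) + (m + g * m) with hM
  have hM0 : 0 < M := by positivity
  set ρ := η / 16 / M with hρ
  have hρ0 : 0 < ρ := by positivity
  have hMρ : M * ρ = η / 16 := by rw [hρ]; field_simp
  have hρ1 : b * (b * (m * (g * c) * ρ)) ≤ η / 16 := by
    have : 0 ≤ (c * (m * g) + (m + g * m)) * ρ := by positivity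
    nlinarith
  have hρ2 : c * (m * g * ρ) ≤ η / 16 := by
    have : 0 ≤ (b * (b * (m * (g * c))) + (m + g * m)) * ρ := by positivity
    nlinarith
  have hρ3 : (m + g * m) * ρ ≤ η / 16 := by
    have : 0 ≤ (b * (b * (m * (g * c))) + c * (m * g)) * ρ := by positivity
    nlinarith
  have hlarge : 2 * (((K : ℝ) + 1) * m) ≤ δ'' * (m * (g * c * b : ℕ)) := by
    rw [div_lt_iff₀ hδ''0] at hc2
    have h1 : (c : ℝ) ≤ m * (g * c * b : ℕ) := by
      exact_mod_cast show c ≤ m * (g * c * b) from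
        calc c = 1 * (1 * c * 1) := by ring
          _ ≤ m * (g * c * b) := by gcongr <;> omega
    nlinarith [mul_le_mul_of_nonneg_left h1 hδ''0.le]
  have hzero : ∃ t < g * c * b, blockPattern z g c b t = 0 := by
    refine ⟨g - 1, ?_, ?_⟩
    · calc g - 1 < g := by omega
        _ = g * 1 * 1 := by ring
        _ ≤ g * c * b := by gcongr <;> omega
    · refine if_neg ?_
      rw [Nat.mod_eq_of_lt (by omega)]
      have := hzg ((g - 1) / (g * c) % b)
      omega
  obtain ⟨f', pos, hpos, hpos0, hbal, hchange, hwin⟩ := h.exists_refinement e he haper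
    (χ := blockPattern z g c b) (fun t => blockPattern_le_one t) (Q := g * c * b)
    (blockPattern_periodic hg hc0) hzero hδ''0 hlarge hρ0
  have hn : ((g * m : ℕ) : ℝ) = g * m := by push_cast; ring
  have hscale : ∀ x y : ℝ, |((m * (g * c * b) : ℕ) : ℝ) * x - c * b * y| ≤
      δ'' * (m * (g * c * b) : ℕ) → |g * m * x - y| ≤ η * A / 8 := by
    intro x y hxy
    push_cast at hxy
    have h1 : (m : ℝ) * (g * c * b) * x - c * b * y = c * b * (g * m * x - y) := by ring
    have hcb : (0 : ℝ) < c * b := by positivity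
    rw [h1, abs_mul, abs_of_pos hcb] at hxy
    exact (le_of_mul_le_mul_left (hxy.trans_eq (by ring)) hcb).trans hδn
  have hmeanK : |g * m * μ.real {x | f' x = K + 1} - (∑ l ∈ Finset.range b, (z l : ℝ)) / b| ≤
      η * A / 8 := by
    have h1 := hbal.abs_measure_sub_le he (i := K + 1) (by simp)
    rw [if_pos rfl, sum_blockPattern (fun l => (hzg l).le) hg hc0] at h1
    refine hscale _ _ ?_
    rw [show (c : ℝ) * b * ((∑ l ∈ Finset.range b, (z l : ℝ)) / b) =
      ((c * ∑ l ∈ Finset.range b, z l : ℕ) : ℝ) by push_cast; field_simp]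
    exact h1
  have hmean : ∀ i ∈ Finset.Icc 1 K, |g * m * μ.real {x | f' x = i} - g * p i| ≤ η * A / 8 := by
    intro i hi
    have hi' := Finset.mem_Icc.1 hi
    have h1 := hbal.abs_measure_sub_le he (i := i) (Finset.mem_Icc.2 ⟨hi'.1, by omega⟩)
    rw [if_neg (by omega)] at h1
    refine hscale _ _ ?_
    rw [show (c : ℝ) * b * (g * p i) = ((g * c * b * p i : ℕ) : ℝ) by push_cast; ring]
    exact h1
  set bad := {x | pos x < m ∨ ∃ j, 1 ≤ j ∧ j ≤ g * m ∧ pos (e^[j] x) = 0} with hbad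
  have hbadμ : μ.real bad ≤ η / 16 := by
    have h1 := hpos.measureReal_bad_le he m (g * m) hpos0
    rw [hn] at h1
    exact (ENNReal.toReal_le_of_le_ofReal (by positivity) h1).trans hρ3
  have hgood : ∀ x, x ∉ bad → m ≤ pos x ∧ ∀ j, 1 ≤ j → j ≤ g * m → pos (e^[j] x) ≠ 0 := by
    intro x hx
    have hx' : ¬ (pos x < m ∨ ∃ j, 1 ≤ j ∧ j ≤ g * m ∧ pos (e^[j] x) = 0) := hx
    push Not at hx'
    exact hx'
  refine ⟨f', _, _, hbal.mono (min_le_left _ _), hchange, ?_, ?_⟩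
  · have hpos0' : μ.real {x | pos x = 0} ≤ ρ := ENNReal.toReal_le_of_le_ofReal hρ0.le hpos0
    have hw : 0 < m * (g * c) := by positivity
    set cross := {x | pos x / (m * g) % c = c - 1} with hcross
    have hcrossμ : μ.real cross ≤ η / 8 := by
      have h1 := hpos.abs_measure_phase_sub_le he hpos0' (w := m * g) (b := c) (l := c - 1)
        (by positivity) (by omega)
      push_cast at h1
      linarith [(abs_le.1 h1).2]
    have hmeas : Measurable fun x => pos x / (m * (g * c)) % b :=
      (measurable_from_nat (f := fun k => k / (m * (g * c)) % b)).comp hpos.1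
    have hX := levyClose_of_discretization (μ := μ) hv
      (κ := b * ((m * (g * c) : ℕ) * ρ)) (by positivity) hmeas (fun x => Nat.mod_lt _ hb)
      (fun j hj => hpos.abs_measure_phase_sub_le he hpos0' hw hj)
    have hY := hX.perturb (γ := η / 4) (X' := fun x => A⁻¹ *
      (visitCount e f' (K + 1) (g * m) x - (g * m : ℕ) * μ.real {x | f' x = K + 1})) ?_
    · refine hY.mono ?_
      push_cast
      linarith
    refine (measureReal_mono (s₂ := bad ∪ cross) ?_).trans ((measureReal_union_le _ _).trans
      (by linarith))
    intro x hx
    by_contra hx'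
    have hx1 : x ∉ bad := fun h => hx' (Or.inl h)
    have hx2 : pos x / (m * g) % c ≠ c - 1 := fun h => hx' (Or.inr h)
    obtain ⟨k1, k2⟩ := hgood x hx1
    have k3 := Nat.abs_cast_sub_le_of_dist_le (hwin g hg x k1 k2).1
    rw [sum_blockPattern_window (fun l => (hzg l).le) _ (by rwa [Nat.div_div_eq_div_mul]) hg hc0,
      Nat.div_div_eq_div_mul] at k3
    have k4 := hzv (pos x / (m * (g * c)) % b) (Nat.mod_lt _ hb)
    set l := pos x / (m * (g * c)) % b with hl
    have hx3 : η / 4 < |v l - A⁻¹ *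
      (visitCount e f' (K + 1) (g * m) x - (g * m : ℕ) * μ.real {x | f' x = K + 1})| := hx
    rw [hn] at hx3
    refine absurd hx3 (not_lt.2 ?_)
    rw [show v l - A⁻¹ * (visitCount e f' (K + 1) (g * m) x - g * m * μ.real {x | f' x = K + 1}) =
      (A * v l - (visitCount e f' (K + 1) (g * m) x - g * m * μ.real {x | f' x = K + 1})) / A by
      field_simp, abs_div, abs_of_pos hA0, div_le_iff₀ hA0, abs_le]
    have i1 := abs_le.1 k3
    have i2 := abs_le.1 k4
    have i3 := abs_le.1 hmeanK
    constructor <;> linarith [i1.1, i1.2, i2.1, i2.2, i3.1, i3.2]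
  · intro i hi
    have hY := (levyClose_dirac (μ := μ) 0).perturb (γ := η) (X' := fun x => A⁻¹ *
      (visitCount e f' i (g * m) x - (g * m : ℕ) * μ.real {x | f' x = i})) ?_
    · rwa [zero_add] at hY
    refine (measureReal_mono (s₂ := bad) ?_).trans (by linarith)
    intro x hx
    by_contra hx'
    obtain ⟨k1, k2⟩ := hgood x hx'
    have k3 := Nat.abs_cast_sub_le_of_dist_le ((hwin g hg x k1 k2).2 i hi)
    push_cast at k3
    have hx3 : η < |0 - A⁻¹ *
      (visitCount e f' i (g * m) x - (g * m : ℕ) * μ.real {x | f' x = i})| := hx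
    rw [hn, zero_sub, abs_neg, abs_mul, abs_of_pos (inv_pos.2 hA0)] at hx3
    refine absurd hx3 (not_lt.2 ?_)
    rw [inv_mul_le_iff₀ hA0, abs_le]
    have i1 := abs_le.1 k3
    have i3 := abs_le.1 (hmean i hi)
    have : 0 < η * A := by positivity
    constructor <;> linarith [i1.1, i1.2, i3.1, i3.2]

end Step

section Limit

variable {Ω : Type*}

/-- The points whose colour is eventually `i` along the sequence of colourings `f`. -/
def limitColor (f : ℕ → Ω → ℕ) (i : ℕ) : Set Ω := {x | ∃ N, ∀ k ≥ N, f k x = i}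

/-- The points whose colour changes at some time after `k`. -/
def changeSet (f : ℕ → Ω → ℕ) (k : ℕ) : Set Ω := {x | ∃ j ≥ k, f j x ≠ f k x}

lemma limitColor_eq_iUnion (f : ℕ → Ω → ℕ) (i : ℕ) :
    limitColor f i = ⋃ N, ⋂ k, {x | N ≤ k → f k x = i} := by
  ext x
  simp only [mem_iUnion, mem_iInter]
  rfl

lemma disjoint_limitColor (f : ℕ → Ω → ℕ) {i j : ℕ} (hij : i ≠ j) :
    Disjoint (limitColor f i) (limitColor f j) := by
  rw [Set.disjoint_left]
  rintro x ⟨N, hN⟩ ⟨M, hM⟩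
  exact hij ((hN _ (le_max_left N M)).symm.trans (hM _ (le_max_right N M)))

lemma mem_limitColor_iff {f : ℕ → Ω → ℕ} {k : ℕ} {x : Ω} (hx : x ∉ changeSet f k) (i : ℕ) :
    x ∈ limitColor f i ↔ f k x = i := by
  have h : ∀ j ≥ k, f j x = f k x := by
    intro j hj
    by_contra hne
    exact hx ⟨j, hj, hne⟩
  constructor
  · rintro ⟨N, hN⟩
    rw [← h _ (le_max_right N k)]
    exact hN _ (le_max_left N k)
  · intro hi
    exact ⟨k, fun j hj => (h j hj).trans hi⟩

variable [MeasurableSpace Ω] {μ : Measure Ω}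

lemma measurableSet_limitColor {f : ℕ → Ω → ℕ} (hf : ∀ k, Measurable (f k)) (i : ℕ) :
    MeasurableSet (limitColor f i) := by
  rw [limitColor_eq_iUnion]
  refine MeasurableSet.iUnion fun N => MeasurableSet.iInter fun k => ?_
  by_cases h : N ≤ k
  · simp only [h, true_imp_iff]
    exact hf k (measurableSet_singleton i)
  · simp [h]

lemma measure_changeSet_le {f : ℕ → Ω → ℕ} {δ : ℕ → ℝ} (hδ : ∀ k, δ (k + 1) ≤ δ k / 2)
    (hδ0 : ∀ k, 0 ≤ δ k) (hf : ∀ k, μ {x | f (k + 1) x ≠ f k x} ≤ ENNReal.ofReal (3 * δ k))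
    (k : ℕ) : μ (changeSet f k) ≤ ENNReal.ofReal (6 * δ k) := by
  have hsub : changeSet f k ⊆ ⋃ j, {x | f (k + j + 1) x ≠ f (k + j) x} := by
    rintro x ⟨j, hj, hne⟩
    by_contra hx
    simp only [mem_iUnion, not_exists] at hx
    have hx' : ∀ j, f (k + j + 1) x = f (k + j) x := fun j => not_not.1 (hx j)
    have : ∀ j, f (k + j) x = f k x := by
      intro j
      induction j with
      | zero => rfl
      | succ j ih => rw [← add_assoc, hx', ih]
    obtain ⟨j, rfl⟩ := Nat.exists_eq_add_of_le hj
    exact hne (this j)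
  have hgeo : ∀ j, ENNReal.ofReal (3 * δ (k + j)) ≤ ENNReal.ofReal (3 * δ k) * 2⁻¹ ^ j := by
    intro j
    have h1 : δ (k + j) ≤ δ k * (2⁻¹) ^ j := by
      induction j with
      | zero => simp
      | succ j ih =>
        have := hδ (k + j)
        rw [pow_succ, ← add_assoc]
        linarith
    have h2 : (2⁻¹ : ENNReal) = ENNReal.ofReal 2⁻¹ := by
      rw [ENNReal.ofReal_inv_of_pos (by norm_num), ENNReal.ofReal_ofNat]
    rw [h2, ← ENNReal.ofReal_pow (by norm_num),
      ← ENNReal.ofReal_mul (mul_nonneg (by norm_num) (hδ0 k))]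
    exact ENNReal.ofReal_le_ofReal (by linarith)
  calc μ (changeSet f k) ≤ ∑' j, μ {x | f (k + j + 1) x ≠ f (k + j) x} :=
        (measure_mono hsub).trans (measure_iUnion_le _)
    _ ≤ ∑' j, ENNReal.ofReal (3 * δ k) * 2⁻¹ ^ j :=
        ENNReal.tsum_le_tsum fun j => (hf (k + j)).trans (hgeo j)
    _ = ENNReal.ofReal (6 * δ k) := by
        rw [ENNReal.tsum_mul_left, ENNReal.tsum_geometric, ENNReal.one_sub_inv_two, inv_inv,
          ← ENNReal.ofReal_ofNat 2, ← ENNReal.ofReal_mul (mul_nonneg (by norm_num) (hδ0 k))]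
        congr 1
        ring

lemma levyDist_indicator_le [IsProbabilityMeasure μ] {T : Ω → Ω} (hT : MeasurePreserving T μ μ)
    {ν : Measure ℝ} {f : Ω → ℕ} {i n : ℕ} {A η γ r : ℝ} {B D : Set Ω} (hA : 0 < A) (hη : 0 < η)
    (hγ : 0 ≤ γ)
    (h : LevyClose μ (fun x => A⁻¹ * (visitCount T f i n x - n * μ.real {x | f x = i})) ν η)
    (hB : MeasurableSet B) (hBD : ∀ x ∉ D, x ∈ B ↔ f x = i) (hr : 0 ≤ r)
    (hD : μ D ≤ ENNReal.ofReal r) (hn : n * r ≤ γ) (hnA : n * r ≤ A * γ) :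
    levyDist (μ.map fun x => A⁻¹ *
      ∑ u ∈ Finset.range n, (B.indicator (fun _ => (1 : ℝ)) (T^[u] x) - (μ B).toReal)) ν ≤
      η + γ := by
  classical
  have hmeas : Measurable fun x => A⁻¹ *
      ∑ u ∈ Finset.range n, (B.indicator (fun _ => (1 : ℝ)) (T^[u] x) - (μ B).toReal) := by
    refine Measurable.const_mul (Finset.measurable_fun_sum _ fun u _ => ?_) _
    exact ((measurable_const.indicator hB).comp (hT.measurable.iterate u)).sub_const _
  refine LevyClose.levyDist_le hmeas (by linarith) (h.perturb ?_)
  have hDr : μ.real D ≤ r := ENNReal.toReal_le_of_le_ofReal hr hD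
  have hdiff : |μ.real B - μ.real {x | f x = i}| ≤ r := by
    have h1 : μ.real B ≤ μ.real {x | f x = i} + μ.real D := by
      refine (measureReal_mono (s₂ := {x | f x = i} ∪ D) fun x hx => ?_).trans
        (measureReal_union_le _ _)
      by_cases hxD : x ∈ D
      · exact Or.inr hxD
      · exact Or.inl ((hBD x hxD).1 hx)
    have h2 : μ.real {x | f x = i} ≤ μ.real B + μ.real D := by
      refine (measureReal_mono (s₂ := B ∪ D) fun x hx => ?_).trans
        (measureReal_union_le _ _)
      by_cases hxD : x ∈ D
      · exact Or.inr hxD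
      · exact Or.inl ((hBD x hxD).2 hx)
    rw [abs_le]
    constructor <;> linarith
  set E := ⋃ u ∈ Finset.range n, T^[u] ⁻¹' toMeasurable μ D with hE
  have hEμ : μ.real E ≤ n * r := by
    refine (measureReal_biUnion_finset_le _ _).trans ?_
    refine (Finset.sum_le_sum (g := fun _ => r) fun u _ => ?_).trans_eq (by simp)
    rw [measureReal_def, measure_preimage_iterate hT u (measurableSet_toMeasurable μ D),
      measure_toMeasurable]
    exact hDr
  refine (measureReal_mono (s₂ := E) (fun x hx => ?_) (measure_ne_top _ _)).trans (hEμ.trans hn)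
  by_contra hxE
  have hxD : ∀ u ∈ Finset.range n, T^[u] x ∉ D := by
    intro u hu hmem
    refine hxE ?_
    simp only [hE, mem_iUnion]
    exact ⟨u, hu, subset_toMeasurable μ D hmem⟩
  have hsum : ∑ u ∈ Finset.range n, (B.indicator (fun _ => (1 : ℝ)) (T^[u] x) - (μ B).toReal) =
      visitCount T f i n x - n * μ.real B := by
    rw [Finset.sum_sub_distrib, Finset.sum_const, Finset.card_range, nsmul_eq_mul, visitCount,
      Nat.cast_sum]
    congr 1
    refine Finset.sum_congr rfl fun u hu => ?_
    by_cases hu' : f (T^[u] x) = i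
    · rw [indicator_of_mem ((hBD _ (hxD u hu)).2 hu'), if_pos hu', Nat.cast_one]
    · rw [indicator_of_notMem (fun hm => hu' ((hBD _ (hxD u hu)).1 hm)), if_neg hu', Nat.cast_zero]
  have hx' : γ < |A⁻¹ * (visitCount T f i n x - n * μ.real {x | f x = i}) - A⁻¹ *
      ∑ u ∈ Finset.range n, (B.indicator (fun _ => (1 : ℝ)) (T^[u] x) - (μ B).toReal)| := hx
  rw [hsum, ← mul_sub, abs_mul, abs_of_pos (inv_pos.2 hA), lt_inv_mul_iff₀ hA,
    show (visitCount T f i n x - n * μ.real {x | f x = i} - (visitCount T f i n x - n * μ.real B) : ℝ)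
      = n * (μ.real B - μ.real {x | f x = i}) by ring, abs_mul, Nat.abs_cast] at hx'
  have := mul_le_mul_of_nonneg_left hdiff (Nat.cast_nonneg (α := ℝ) n)
  linarith

end Limit

section Construction

/-- Dependent choice along the natural numbers. -/
lemma exists_seq_of_step {S : Type*} {P : ℕ → S → Prop} {R : ℕ → S → S → Prop} {s₀ : S}
    (h₀ : P 0 s₀) (h : ∀ k s, P k s → ∃ s', P (k + 1) s' ∧ R k s s') :
    ∃ s : ℕ → S, s 0 = s₀ ∧ ∀ k, P k (s k) ∧ R k (s k) (s (k + 1)) := by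
  have : Nonempty S := ⟨s₀⟩
  choose! F hF using h
  let s : ℕ → S := fun k => Nat.rec s₀ F k
  have hP : ∀ k, P k (s k) := by
    intro k
    induction k with
    | zero => exact h₀
    | succ k ih => exact (hF k (s k) ih).1
  exact ⟨s, rfl, fun k => ⟨hP k, (hF k (s k) (hP k)).2⟩⟩

/-- The data produced at one stage of the construction: a colouring, its block length, its block
counts, its error and its time scale. -/
structure ColoringStage (Ω : Type*) where
  color : Ω → ℕ
  block : ℕ
  count : ℕ → ℕ
  error : ℝ
  time : ℕ

variable {Ω : Type*} [MeasurableSpace Ω]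

/-- The relation between two consecutive stages of the construction. -/
structure ColoringStage.Step (μ : Measure Ω) (T : Ω → Ω) (a : ℕ → ℝ) (ν : ℕ → Measure ℝ)
    (εs : ℕ → ℝ) (k : ℕ) (s s' : ColoringStage Ω) : Prop where
  time_lt : s.time < s'.time
  error_le : s'.error ≤ s.error / 2
  error_le_ratio : 6 * s'.error ≤ a s'.time / s'.time * εs (k + 2)
  error_le_time : s'.time * (6 * s'.error) ≤ εs (k + 1) / 2
  error_le_scale : s'.time * (6 * s'.error) ≤ a s'.time * (εs (k + 1) / 2)
  change : μ {x | s'.color x ≠ s.color x} ≤ ENNReal.ofReal (3 * s.error)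
  close : LevyClose μ (fun x => (a s'.time)⁻¹ * (visitCount T s'.color (k + 1) s'.time x -
    s'.time * μ.real {x | s'.color x = k + 1})) (ν (k + 1)) (εs (k + 1) / 2)
  close_zero : ∀ i ∈ Finset.Icc 1 k, LevyClose μ (fun x => (a s'.time)⁻¹ *
    (visitCount T s'.color i s'.time x - s'.time * μ.real {x | s'.color x = i}))
    (Measure.dirac 0) (εs (k + 1) / 2)

lemma exists_coloringStages [StandardBorelSpace Ω] {μ : Measure Ω} [IsProbabilityMeasure μ]
    (e : Ω ≃ᵐ Ω) (he : MeasurePreserving e μ μ) (haper : μ {x | ∃ n ≥ 1, e^[n] x = x} = 0)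
    {a : ℕ → ℝ} (ha_pos : ∀ n, 0 < a n) (ha_top : Tendsto a atTop atTop)
    (ha_small : Tendsto (fun n => a n / n) atTop (𝓝 0))
    {ν : ℕ → Measure ℝ} (hν : ∀ k ≥ 1, IsProbabilityMeasure (ν k))
    {εs : ℕ → ℝ} (hεs : ∀ k ≥ 1, 0 < εs k) :
    ∃ s : ℕ → ColoringStage Ω, 6 * (s 0).error ≤ εs 1 ∧ ∀ k,
      Measurable (s k).color ∧ (∀ x, (s k).color x ≤ k) ∧ 0 < (s k).error ∧
      (s k).Step μ e a ν εs k (s (k + 1)) := by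
  have h1 := hεs 1 le_rfl
  obtain ⟨m, hm⟩ := exists_nat_gt (εs 1 / 6)⁻¹
  have hm0 : (0 : ℝ) < m := lt_trans (by positivity) hm
  let s₀ : ColoringStage Ω := ⟨fun _ => 0, m, fun _ => 0, εs 1 / 6, 0⟩
  let P : ℕ → ColoringStage Ω → Prop := fun k s =>
    BalancedColoring μ e k s.color s.block s.count s.error ∧ 0 < s.error
  have h₀ : P 0 s₀ := by
    refine ⟨⟨measurable_const, fun _ => le_rfl, ?_, ?_, ?_⟩, by positivity⟩
    · simpa using hm0
    · rw [inv_lt_iff_one_lt_mul₀ (by positivity)] at hm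
      exact hm.le.trans_eq (mul_comm _ _)
    · simp
  have hstep : ∀ k s, P k s → ∃ s', P (k + 1) s' ∧ s.Step μ e a ν εs k s' := by
    rintro k s ⟨hbal, herr⟩
    have := hν (k + 1) (by omega)
    have hε1 := hεs (k + 1) (by omega)
    have hε2 := hεs (k + 2) (by omega)
    obtain ⟨n, hn, hstep⟩ := hbal.exists_levyClose e he haper ha_pos ha_top ha_small (ν (k + 1))
      (half_pos hε1) (s.time + 1)
    have hn0 : (0 : ℝ) < n := by exact_mod_cast (by omega : 0 < n)
    have ha := ha_pos n
    obtain ⟨δ, hδ0, hδ1, hδ2, hδ3, hδ4⟩ : ∃ δ > 0, δ ≤ s.error / 2 ∧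
        δ ≤ a n / n * εs (k + 2) / 6 ∧ δ ≤ εs (k + 1) / 2 / (n * 6) ∧
        δ ≤ a n * (εs (k + 1) / 2) / (n * 6) :=
      ⟨min (min (s.error / 2) (a n / n * εs (k + 2) / 6))
        (min (εs (k + 1) / 2 / (n * 6)) (a n * (εs (k + 1) / 2) / (n * 6))), by positivity,
        (min_le_left _ _).trans (min_le_left _ _), (min_le_left _ _).trans (min_le_right _ _),
        (min_le_right _ _).trans (min_le_left _ _), (min_le_right _ _).trans (min_le_right _ _)⟩
    obtain ⟨f', m', p', hbal', hchange, hclose, hzero⟩ := hstep δ hδ0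
    rw [le_div_iff₀' (by positivity)] at hδ2 hδ3 hδ4
    rw [mul_assoc] at hδ3 hδ4
    exact ⟨⟨f', m', p', δ, n⟩, ⟨hbal', hδ0⟩, ⟨hn, hδ1, hδ2, hδ3, hδ4, hchange, hclose, hzero⟩⟩
  obtain ⟨s, hs0, hs⟩ := exists_seq_of_step h₀ hstep
  refine ⟨s, ?_, fun k => ⟨(hs k).1.1.1, (hs k).1.1.2.1, (hs k).1.2, (hs k).2⟩⟩
  rw [hs0]
  exact (mul_div_cancel₀ _ (by norm_num)).le

end Construction

/-- the key proposition. In an aperiodic dynamical system on a standard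
Borel probability space, given zero-mean probability measures `ν k` (`k ≥ 1`),
`ε ∈ (0,1)` and a decreasing sequence `εs k > 0` with `∑ εs k < ε` and
`∑ k * εs k < ∞`, there are pairwise disjoint measurable sets `A k` and a strictly
increasing sequence of positive integers `n k` (`k ≥ 1`) satisfying the measure bounds
(i), the approximation property (ii), and the negligibility property (iii). -/
theorem exists_disjoint_sets_proposition
    {Ω : Type*} [MeasurableSpace Ω] [StandardBorelSpace Ω]
    (μ : Measure Ω) [IsProbabilityMeasure μ]
    (T : Ω → Ω) (hT : MeasurePreserving T μ μ) (hTbij : Function.Bijective T)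
    (haper : μ {x | ∃ n ≥ 1, T^[n] x = x} = 0)
    (a : ℕ → ℝ) (ha_pos : ∀ n, 0 < a n) (ha_mono : Monotone a)
    (ha_top : Tendsto a atTop atTop)
    (ha_small : Tendsto (fun n => a n / n) atTop (𝓝 0))
    (ν : ℕ → Measure ℝ) (hν_prob : ∀ k ≥ 1, IsProbabilityMeasure (ν k))
    (hν_int : ∀ k ≥ 1, Integrable (fun x : ℝ => x) (ν k))
    (hν_mean : ∀ k ≥ 1, ∫ x, x ∂(ν k) = 0)
    (ε : ℝ) (hε : 0 < ε) (hε1 : ε < 1)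
    (εs : ℕ → ℝ) (hεs_pos : ∀ k ≥ 1, 0 < εs k)
    (hεs_dec : ∀ k ≥ 1, εs (k + 1) ≤ εs k)
    (hεs_summable : Summable fun k : ℕ => εs (k + 1))
    (hεs_sum : ∑' k : ℕ, εs (k + 1) < ε)
    (hεs_ksummable : Summable fun k : ℕ => ((k + 1 : ℕ) : ℝ) * εs (k + 1)) :
    ∃ A : ℕ → Set Ω, ∃ n : ℕ → ℕ,
      (∀ k ≥ 1, MeasurableSet (A k)) ∧
      (∀ j ≥ 1, ∀ k ≥ 1, j ≠ k → Disjoint (A j) (A k)) ∧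
      1 ≤ n 1 ∧ (∀ k ≥ 1, n k < n (k + 1)) ∧
      -- (i)
      μ (A 1) ≤ ENNReal.ofReal (εs 1) ∧
      (∀ k > 1, μ (A k) ≤ ENNReal.ofReal (a (n (k - 1)) / (n (k - 1)) * εs k)) ∧
      -- (ii)
      (∀ k ≥ 1,
        levyDist
          (μ.map (fun x => (a (n k))⁻¹ *
            ∑ i ∈ Finset.range (n k),
              ((A k).indicator (fun _ => (1 : ℝ)) (T^[i] x) - (μ (A k)).toReal)))
          (ν k) ≤ εs k) ∧
      -- (iii)
      (∀ k ≥ 1, ∀ j > k,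
        levyDist
          (μ.map (fun x => (a (n j))⁻¹ *
            ∑ i ∈ Finset.range (n j),
              ((A k).indicator (fun _ => (1 : ℝ)) (T^[i] x) - (μ (A k)).toReal)))
          (Measure.dirac 0) ≤ εs j) := by
  have hemb := hT.measurable.measurableEmbedding hTbij.injective
  let e : Ω ≃ᵐ Ω :=
    { toEquiv := Equiv.ofBijective T hTbij
      measurable_toFun := hT.measurable
      measurable_invFun := by
        intro s hs
        rw [← Equiv.image_eq_preimage_symm]
        exact hemb.measurableSet_image.2 hs }
  have heT : ⇑e = T := rfl
  obtain ⟨s, hs0, hs⟩ := exists_coloringStages e (heT ▸ hT) (heT ▸ haper) ha_pos ha_top ha_small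
    hν_prob hεs_pos
  rw [heT] at hs
  set f : ℕ → Ω → ℕ := fun k => (s k).color with hf
  have hfm : ∀ k, Measurable (f k) := fun k => (hs k).1
  have hD : ∀ k, μ (changeSet f k) ≤ ENNReal.ofReal (6 * (s k).error) :=
    measure_changeSet_le (fun k => (hs k).2.2.2.error_le) (fun k => (hs k).2.2.1.le)
      (fun k => (hs k).2.2.2.change)
  have hsub : ∀ k, μ (limitColor f (k + 1)) ≤ ENNReal.ofReal (6 * (s k).error) := by
    refine fun k => (measure_mono fun x hx => ?_).trans (hD k)
    by_contra hx'
    have h1 := (mem_limitColor_iff hx' _).1 hx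
    have h2 : f k x ≤ k := (hs k).2.1 x
    omega
  have hdist : ∀ k i (ν' : Measure ℝ), LevyClose μ (fun x => (a (s (k + 1)).time)⁻¹ *
      (visitCount T (f (k + 1)) i (s (k + 1)).time x -
        (s (k + 1)).time * μ.real {x | f (k + 1) x = i})) ν' (εs (k + 1) / 2) →
      levyDist (μ.map (fun x => (a (s (k + 1)).time)⁻¹ *
        ∑ u ∈ Finset.range (s (k + 1)).time,
          ((limitColor f i).indicator (fun _ => (1 : ℝ)) (T^[u] x) -
            (μ (limitColor f i)).toReal))) ν' ≤ εs (k + 1) := by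
    intro k i ν' hclose
    have hε' := hεs_pos (k + 1) (by omega)
    have := levyDist_indicator_le hT (ha_pos _) (half_pos hε') (half_pos hε').le hclose
      (measurableSet_limitColor hfm i) (fun x hx => mem_limitColor_iff hx i)
      (mul_nonneg (by norm_num) (hs (k + 1)).2.2.1.le) (hD (k + 1))
      (hs k).2.2.2.error_le_time (hs k).2.2.2.error_le_scale
    rwa [add_halves] at this
  refine ⟨limitColor f, fun k => (s k).time, fun k _ => measurableSet_limitColor hfm k,
    fun j _ k _ hjk => disjoint_limitColor f hjk, ?_, fun k _ => (hs k).2.2.2.time_lt, ?_, ?_, ?_, ?_⟩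
  · exact Nat.one_le_iff_ne_zero.2 (Nat.ne_of_gt ((Nat.zero_le _).trans_lt (hs 0).2.2.2.time_lt))
  · exact (hsub 0).trans (ENNReal.ofReal_le_ofReal hs0)
  · intro k hk
    obtain ⟨k, rfl⟩ := Nat.exists_eq_add_of_le' hk
    exact (hsub (k + 1)).trans (ENNReal.ofReal_le_ofReal (hs k).2.2.2.error_le_ratio)
  · intro k hk
    obtain ⟨k, rfl⟩ := Nat.exists_eq_add_of_le' hk
    exact hdist k (k + 1) _ (hs k).2.2.2.close
  · intro i hi j hj
    obtain ⟨k, rfl⟩ := Nat.exists_eq_add_of_le' (show 1 ≤ j by omega)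
    exact hdist k i _ ((hs k).2.2.2.close_zero i (Finset.mem_Icc.2 ⟨hi, by omega⟩))
end
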